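/- Let G be a triangle-free planar graph and let X be an independent set of vertices of G. If L is a list assignment with |L(v)| = 4 for every vertex v not in X and |L(v)| = 3 for every vertex v in X, then G admits a proper L-colouring (a colouring φ with φ(v) ∈ L(v) for all v and φ(x) ≠ φ(y) for every edge xy). -/

import Mathlib

structure PlaneEmbedding {V : Type} (G : SimpleGraph V) where
  pos : V → ℝ × ℝ
  arc : V → V → Set.Icc (0:ℝ) 1 → ℝ × ℝ
  pos_inj : Function.Injective pos
  arc_cont : ∀ u v, G.Adj u v → Continuous (arc u v)
  arc_inj : ∀ u v, G.Adj u v → Function.Injective (arc u v)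
  arc_start : ∀ u v, G.Adj u v → arc u v ⟨0, by norm_num⟩ = pos u
  arc_end : ∀ u v, G.Adj u v → arc u v ⟨1, by norm_num⟩ = pos v
  arc_symm : ∀ u v, G.Adj u v → Set.range (arc u v) = Set.range (arc v u)
  arc_avoid : ∀ u v w, G.Adj u v → w ≠ u → w ≠ v → pos w ∉ Set.range (arc u v)
  arcs_meet_only_at_endpoints : ∀ u v x y, G.Adj u v → G.Adj x y →
    ({u, v} : Set V) ≠ {x, y} →
    Set.range (arc u v) ∩ Set.range (arc x y) ⊆ pos '' (({u, v} : Set V) ∩ {x, y})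

/-- A graph is planar if it admits a drawing in the plane. -/
def SimpleGraph.IsPlanar {V : Type} (G : SimpleGraph V) : Prop := Nonempty (PlaneEmbedding G)
/-- A proper colouring of `G` from the lists `L`. -/
def ProperListColoring {V : Type} (G : SimpleGraph V) (L : V → Finset ℕ) (φ : V → ℕ) : Prop :=
  (∀ v, φ v ∈ L v) ∧ ∀ u v, G.Adj u v → φ u ≠ φ v

namespace PlanarChoice

variable {V : Type}

/-- `A` is closed under passing to neighbours inside `S`. -/
def ClosedIn (H : SimpleGraph V) (S A : Set V) : Prop :=
  ∀ a ∈ A, ∀ b ∈ S, H.Adj a b → b ∈ A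

/-- `S` induces a connected or empty subgraph. -/
def PreConn (H : SimpleGraph V) (S : Set V) : Prop :=
  ∀ A ⊆ S, A.Nonempty → ClosedIn H S A → A = S

/-- `S` induces a connected subgraph. -/
def Conn (H : SimpleGraph V) (S : Set V) : Prop := S.Nonempty ∧ PreConn H S

/-- There is an edge between `A` and `B`. -/
def Touch (H : SimpleGraph V) (A B : Set V) : Prop := ∃ a ∈ A, ∃ b ∈ B, H.Adj a b

/-- The component of `x` in the subgraph induced on `S`. -/
def comp (H : SimpleGraph V) (S : Set V) (x : V) : Set V :=
  {y | Relation.ReflTransGen (fun a b => H.Adj a b ∧ b ∈ S) x y}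

variable {H : SimpleGraph V} {S A B C : Set V} {x y : V}

lemma Touch.symm (h : Touch H A B) : Touch H B A := by
  obtain ⟨a, ha, b, hb, hab⟩ := h
  exact ⟨b, hb, a, ha, hab.symm⟩

lemma Touch.mono {A' B' : Set V} (h : Touch H A B) (hA : A ⊆ A') (hB : B ⊆ B') :
    Touch H A' B' := by
  obtain ⟨a, ha, b, hb, hab⟩ := h
  exact ⟨a, hA ha, b, hB hb, hab⟩

lemma conn_singleton (x : V) : Conn H {x} := by
  refine ⟨⟨x, rfl⟩, fun A hA hne _ => ?_⟩
  exact (Set.subset_singleton_iff_eq.1 hA).resolve_left hne.ne_empty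

lemma Conn.nonempty (h : Conn H S) : S.Nonempty := h.1

lemma PreConn.touch (h : PreConn H S) (hA : A ⊆ S) (hne : A.Nonempty) (hx : x ∈ S)
    (hxA : x ∉ A) : ∃ a ∈ A, ∃ b ∈ S, b ∉ A ∧ H.Adj a b := by
  by_contra! hcon
  have := h A hA hne (fun a ha b hb hab => by
    by_contra hbA
    exact hcon a ha b hb hbA hab)
  exact hxA (this ▸ hx)

lemma Conn.union (hA : Conn H A) (hB : Conn H B) (h : Touch H A B) : Conn H (A ∪ B) := by
  refine ⟨hA.1.mono Set.subset_union_left, fun W hW hne hcl => ?_⟩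
  obtain ⟨a, ha, b, hb, hab⟩ := h
  have key : ∀ {X : Set V}, X ⊆ A ∪ B → PreConn H X → (W ∩ X).Nonempty → X ⊆ W := by
    intro X hX hp hn
    have := hp (W ∩ X) Set.inter_subset_right hn
      (fun u hu v hv huv => ⟨hcl u hu.1 v (hX hv) huv, hv⟩)
    exact Set.inter_eq_right.1 this
  apply hW.antisymm
  obtain ⟨w, hw⟩ := hne
  rcases hW hw with hwA | hwB
  · have h1 := key Set.subset_union_left hA.2 ⟨w, hw, hwA⟩
    have h2 : b ∈ W := hcl a (h1 ha) b (Or.inr hb) hab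
    exact Set.union_subset h1 (key Set.subset_union_right hB.2 ⟨b, h2, hb⟩)
  · have h1 := key Set.subset_union_right hB.2 ⟨w, hw, hwB⟩
    have h2 : a ∈ W := hcl b (h1 hb) a (Or.inl ha) hab.symm
    exact Set.union_subset (key Set.subset_union_left hA.2 ⟨a, h2, ha⟩) h1

lemma Conn.union_of_forall (hA : Conn H A) (h : ∀ b ∈ B, ∃ a ∈ A, H.Adj a b) :
    Conn H (A ∪ B) := by
  refine ⟨hA.1.mono Set.subset_union_left, fun W hW hne hcl => ?_⟩
  apply hW.antisymm
  have hAW : A ⊆ W := by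
    have hn : (W ∩ A).Nonempty := by
      obtain ⟨w, hw⟩ := hne
      rcases hW hw with hwA | hwB
      · exact ⟨w, hw, hwA⟩
      · obtain ⟨a, ha, hab⟩ := h w hwB
        exact ⟨a, hcl w hw a (Or.inl ha) hab.symm, ha⟩
    have := hA.2 (W ∩ A) Set.inter_subset_right hn
      (fun u hu v hv huv => ⟨hcl u hu.1 v (Or.inl hv) huv, hv⟩)
    exact Set.inter_eq_right.1 this
  refine Set.union_subset hAW fun b hb => ?_
  obtain ⟨a, ha, hab⟩ := h b hb
  exact hcl a (hAW ha) b (Or.inr hb) hab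

lemma mem_comp_self : x ∈ comp H S x := Relation.ReflTransGen.refl

lemma comp_subset (hx : x ∈ S) : comp H S x ⊆ S := by
  intro y hy
  induction hy with
  | refl => exact hx
  | tail _ h _ => exact h.2

lemma comp_closed : ClosedIn H S (comp H S x) := fun _ ha _ hb hab => ha.tail ⟨hab, hb⟩

lemma comp_subset_of_closed (hA : ClosedIn H S A) (hx : x ∈ A) : comp H S x ⊆ A := by
  intro y hy
  induction hy with
  | refl => exact hx
  | tail _ h ih => exact hA _ ih _ h.2 h.1

lemma comp_conn (hx : x ∈ S) : Conn H (comp H S x) := by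
  refine ⟨⟨x, mem_comp_self⟩, fun A hA hne hcl => ?_⟩
  have hcl' : ClosedIn H S A := fun a ha b hb hab => hcl a ha b (comp_closed a (hA ha) b hb hab) hab
  have hsub : ClosedIn H S (S \ A) := fun a ha b hb hab =>
    ⟨hb, fun hbA => ha.2 (hcl' b hbA a ha.1 hab.symm)⟩
  by_cases hxA : x ∈ A
  · exact hA.antisymm (comp_subset_of_closed hcl' hxA)
  · obtain ⟨a, ha⟩ := hne
    exact absurd ha (comp_subset_of_closed hsub ⟨hx, hxA⟩ (hA ha)).2

lemma comp_eq_of_mem (hx : x ∈ S) (hy : y ∈ comp H S x) : comp H S y = comp H S x := by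
  have h1 : comp H S y ⊆ comp H S x := comp_subset_of_closed comp_closed hy
  exact (comp_conn hx).2 _ h1 ⟨y, mem_comp_self⟩
    (fun a ha b hb hab => comp_closed a ha b (comp_subset hx hb) hab)

lemma comp_disjoint_or_eq {x y : V} (hx : x ∈ S) (hy : y ∈ S) :
    comp H S x = comp H S y ∨ Disjoint (comp H S x) (comp H S y) := by
  by_cases h : Disjoint (comp H S x) (comp H S y)
  · exact Or.inr h
  · obtain ⟨z, hz1, hz2⟩ := Set.not_disjoint_iff.1 h
    exact Or.inl ((comp_eq_of_mem hx hz1).symm.trans (comp_eq_of_mem hy hz2))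

lemma Conn.subset_comp (hA : Conn H A) (hAS : A ⊆ S) (hx : x ∈ A) : A ⊆ comp H S x := by
  have := hA.2 (comp H S x ∩ A) Set.inter_subset_right ⟨x, mem_comp_self, hx⟩
    (fun u hu v hv huv => ⟨comp_closed u hu.1 v (hAS hv) huv, hv⟩)
  exact Set.inter_eq_right.1 this

/-- No five disjoint connected sets that pairwise touch. -/
def NoK5 (H : SimpleGraph V) : Prop :=
  ∀ A : Fin 5 → Set V, (∀ i, Conn H (A i)) → (∀ i j, i < j → Disjoint (A i) (A j)) →
    ¬ ∀ i j, i < j → Touch H (A i) (A j)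

/-- No six disjoint connected sets touching in the pattern `K₃,₃`. -/
def NoK33 (H : SimpleGraph V) : Prop :=
  ∀ A : Fin 6 → Set V, (∀ i, Conn H (A i)) → (∀ i j, i < j → Disjoint (A i) (A j)) →
    ¬ ∀ i j : Fin 6, i < 3 → 3 ≤ j → Touch H (A i) (A j)

lemma NoK5.elim (h : NoK5 H) {A B C D E : Set V}
    (hA : Conn H A) (hB : Conn H B) (hC : Conn H C) (hD : Conn H D) (hE : Conn H E)
    (AB : Disjoint A B) (AC : Disjoint A C) (AD : Disjoint A D) (AE : Disjoint A E)
    (BC : Disjoint B C) (BD : Disjoint B D) (BE : Disjoint B E)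
    (CD : Disjoint C D) (CE : Disjoint C E) (DE : Disjoint D E)
    (tAB : Touch H A B) (tAC : Touch H A C) (tAD : Touch H A D) (tAE : Touch H A E)
    (tBC : Touch H B C) (tBD : Touch H B D) (tBE : Touch H B E)
    (tCD : Touch H C D) (tCE : Touch H C E) (tDE : Touch H D E) : False := by
  refine h ![A, B, C, D, E] ?_ ?_ ?_
  · intro i; fin_cases i <;> assumption
  · intro i j hij; fin_cases i <;> fin_cases j <;> first | assumption | exact absurd hij (by decide)
  · intro i j hij; fin_cases i <;> fin_cases j <;> first | assumption | exact absurd hij (by decide)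

lemma NoK33.elim (h : NoK33 H) {A B C X Y Z : Set V}
    (hA : Conn H A) (hB : Conn H B) (hC : Conn H C) (hX : Conn H X) (hY : Conn H Y)
    (hZ : Conn H Z)
    (AB : Disjoint A B) (AC : Disjoint A C) (BC : Disjoint B C)
    (XY : Disjoint X Y) (XZ : Disjoint X Z) (YZ : Disjoint Y Z)
    (AX : Disjoint A X) (AY : Disjoint A Y) (AZ : Disjoint A Z)
    (BX : Disjoint B X) (BY : Disjoint B Y) (BZ : Disjoint B Z)
    (CX : Disjoint C X) (CY : Disjoint C Y) (CZ : Disjoint C Z)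
    (tAX : Touch H A X) (tAY : Touch H A Y) (tAZ : Touch H A Z)
    (tBX : Touch H B X) (tBY : Touch H B Y) (tBZ : Touch H B Z)
    (tCX : Touch H C X) (tCY : Touch H C Y) (tCZ : Touch H C Z) : False := by
  refine h ![A, B, C, X, Y, Z] ?_ ?_ ?_
  · intro i; fin_cases i <;> assumption
  · intro i j hij; fin_cases i <;> fin_cases j <;> first | assumption | exact absurd hij (by decide)
  · intro i j hi hj; fin_cases i <;> fin_cases j <;>
      first | assumption | exact absurd hi (by decide) | exact absurd hj (by decide)

end PlanarChoice

namespace PlanarChoice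

open Classical in
/-- The quantity that must be at least `4` at an ordinary vertex `v`: the list size, plus one if
`v` has a neighbour in `Z`, plus one if `v ∈ D`. -/
noncomputable def weight {V : Type} (H : SimpleGraph V) (D Z : Set V) (L : V → Finset ℕ) (v : V) :
    ℕ :=
  (L v).card + (if ∃ z ∈ Z, H.Adj z v then 1 else 0) + (if v ∈ D then 1 else 0)

variable {V : Type}

/-- The vertices with a neighbour in `Z`. -/
def Nb (H : SimpleGraph V) (Z : Set V) : Set V := {v | ∃ z ∈ Z, H.Adj z v}

/-- The subgraph induced on `U` can be properly coloured from the lists `L`. -/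
def Col (H : SimpleGraph V) (U : Set V) (L : V → Finset ℕ) : Prop :=
  ∃ φ : V → ℕ, (∀ v ∈ U, φ v ∈ L v) ∧ ∀ u ∈ U, ∀ v ∈ U, H.Adj u v → φ u ≠ φ v

/-- An instance with outer set `Z` and one or two precoloured vertices `p`, `q`. -/
structure Inst (H : SimpleGraph V) (D Z U : Set V) (p q : V) (L : V → Finset ℕ) : Prop where
  connZ : Conn H Z
  disj : Disjoint Z U
  hp : p ∈ U
  hq : q ∈ U
  pO : p ∈ Nb H Z
  qO : q ∈ Nb H Z
  pq : p = q ∨ H.Adj p q ∧ Disjoint (L p) (L q)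
  pne : (L p).Nonempty
  qne : (L q).Nonempty
  big : ∀ v ∈ U, v ≠ p → v ≠ q → 4 ≤ weight H D Z L v

/-- An instance without precoloured vertices. -/
structure Inst0 (H : SimpleGraph V) (D Z U : Set V) (L : V → Finset ℕ) : Prop where
  connZ : Conn H Z ∨ Z = ∅
  disj : Disjoint Z U
  big : ∀ v ∈ U, 4 ≤ weight H D Z L v

/-- All instances on fewer than `n` vertices are colourable. -/
def Tlt (H : SimpleGraph V) (D : Set V) (n : ℕ) : Prop :=
  ∀ Z U p q L, U.ncard < n → Inst H D Z U p q L → Col H U L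

variable {H : SimpleGraph V} {D Z U : Set V} {p q : V} {L : V → Finset ℕ} {n : ℕ}

lemma weight_le_of (L' : V → Finset ℕ) {Z' : Set V} {v : V} (h : 4 ≤ weight H D Z L v)
    (h1 : v ∈ Nb H Z → v ∈ Nb H Z' ∧ (L v).card ≤ (L' v).card)
    (h2 : v ∉ Nb H Z → (L v).card ≤ (L' v).card ∨
      v ∈ Nb H Z' ∧ (L v).card ≤ (L' v).card + 1) :
    4 ≤ weight H D Z' L' v := by
  unfold weight at *
  simp only [Nb, Set.mem_ofPred_eq] at h1 h2
  by_cases a : ∃ z ∈ Z, H.Adj z v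
  · obtain ⟨h3, h4⟩ := h1 a
    rw [if_pos a] at h
    rw [if_pos h3]
    omega
  · rw [if_neg a] at h
    rcases h2 a with h3 | ⟨h3, h4⟩
    · split_ifs at * <;> omega
    · rw [if_pos h3]; omega

lemma weight_list_pos {v : V} (h : 4 ≤ weight H D Z L v) : 2 ≤ (L v).card := by
  unfold weight at h
  split_ifs at h <;> omega

lemma Nb_mono {Z Z' : Set V} (h : Z ⊆ Z') : Nb H Z ⊆ Nb H Z' :=
  fun _ ⟨z, hz, hzv⟩ => ⟨z, h hz, hzv⟩

lemma Col.glue {K S : Set V} {L : V → Finset ℕ} (φ : V → ℕ)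
    (hφ : ∀ v ∈ U \ K, φ v ∈ L v)
    (hφ' : ∀ u ∈ U \ K, ∀ v ∈ U \ K, H.Adj u v → φ u ≠ φ v)
    (χ : V → ℕ) (hχ : ∀ v ∈ K, χ v ∈ L v)
    (hχ' : ∀ u ∈ K ∪ S, ∀ v ∈ K ∪ S, H.Adj u v → χ u ≠ χ v)
    (hS : ∀ v ∈ S, χ v = φ v)
    (hK : ∀ u ∈ K, ∀ v ∈ U \ K, H.Adj u v → v ∈ S) : Col H U L := by
  classical
  refine ⟨fun v => if v ∈ K then χ v else φ v, fun v hv => ?_, fun u hu v hv huv => ?_⟩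
  · by_cases h : v ∈ K
    · simpa [h] using hχ v h
    · simpa [h] using hφ v ⟨hv, h⟩
  · by_cases h : u ∈ K <;> by_cases h' : v ∈ K <;> simp only [h, h', if_true, if_false]
    · exact hχ' u (Or.inl h) v (Or.inl h') huv
    · have := hK u h v ⟨hv, h'⟩ huv
      rw [← hS v this]
      exact hχ' u (Or.inl h) v (Or.inr this) huv
    · have := hK v h' u ⟨hu, h⟩ huv.symm
      rw [← hS u this]
      exact hχ' u (Or.inr this) v (Or.inl h') huv
    · exact hφ' u ⟨hu, h⟩ v ⟨hv, h'⟩ huv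

lemma Inst0.col [Finite V] (hT : Tlt H D n) (hU : U.ncard < n) (h : Inst0 H D Z U L) :
    Col H U L := by
  classical
  induction hk : U.ncard using Nat.strong_induction_on generalizing U Z L with
  | _ k ih =>
  subst hk
  by_cases hO : ∃ p ∈ U, p ∈ Nb H Z
  · obtain ⟨p, hpU, hpO⟩ := hO
    have hZ : Conn H Z := by
      rcases h.connZ with hZ | hZ
      · exact hZ
      · subst hZ; obtain ⟨z, hz, _⟩ := hpO; exact hz.elim
    have hne : (L p).Nonempty := by
      have := weight_list_pos (h.big p hpU)
      exact Finset.card_pos.1 (by omega)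
    exact hT Z U p p L hU ⟨hZ, h.disj, hpU, hpU, hpO, hpO, Or.inl rfl, hne, hne,
      fun v hv _ _ => h.big v hv⟩
  · push Not at hO
    rcases U.eq_empty_or_nonempty with rfl | ⟨u, hu⟩
    · exact ⟨fun _ => 0, by simp, by simp⟩
    have hc := weight_list_pos (h.big u hu)
    obtain ⟨c, hc⟩ : (L u).Nonempty := Finset.card_pos.1 (by omega)
    have hlt : (U \ {u}).ncard < U.ncard := Set.ncard_sdiff_singleton_lt_of_mem hu
    let L' : V → Finset ℕ := fun v => if H.Adj u v then (L v).erase c else L v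
    have h' : Inst0 H D {u} (U \ {u}) L' := by
      refine ⟨Or.inl (conn_singleton u), Set.disjoint_sdiff_right, fun v hv => ?_⟩
      refine weight_le_of L' (h.big v hv.1) (fun h1 => absurd h1 (hO v hv.1)) fun _ => ?_
      by_cases hadj : H.Adj u v
      · refine Or.inr ⟨⟨u, rfl, hadj⟩, ?_⟩
        simp only [L', hadj, if_true]
        have := Finset.pred_card_le_card_erase (s := L v) (a := c)
        omega
      · exact Or.inl (by simp [L', hadj])
    obtain ⟨φ, h1, h2⟩ := ih _ hlt (hlt.trans hU) h' rfl
    refine ⟨Function.update φ u c, fun v hv => ?_, fun a ha b hb hab => ?_⟩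
    · by_cases hvu : v = u
      · subst hvu; simpa using hc
      · rw [Function.update_of_ne hvu]
        have := h1 v ⟨hv, hvu⟩
        simp only [L'] at this
        split_ifs at this
        · exact Finset.mem_of_mem_erase this
        · exact this
    · have key : ∀ b ∈ U, b ≠ u → H.Adj u b → φ b ≠ c := by
        intro b hb hbu hab
        have := h1 b ⟨hb, hbu⟩
        simp only [L', hab, if_true] at this
        exact Finset.ne_of_mem_erase this
      by_cases hau : a = u <;> by_cases hbu : b = u
      · subst hau; subst hbu; exact (H.irrefl hab).elim
      · subst hau
        rw [Function.update_self, Function.update_of_ne hbu]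
        exact (key b hb hbu hab).symm
      · subst hbu
        rw [Function.update_self, Function.update_of_ne hau]
        exact key a ha hau hab.symm
      · rw [Function.update_of_ne hau, Function.update_of_ne hbu]
        exact h2 a ⟨ha, hau⟩ b ⟨hb, hbu⟩ hab

/-- Colour a subset `Q` of the boundary, absorb it into `Z`, and colour the rest. -/
lemma removal (hT : Tlt H D n) {Q : Set V} (hn : (U \ Q).ncard < n)
    (hZ : Conn H Z) (hdisj : Disjoint Z U) (hQO : Q ⊆ Nb H Z)
    (hp : p ∈ U \ Q) (hq : q ∈ U \ Q) (hpO : p ∈ Nb H (Z ∪ Q)) (hqO : q ∈ Nb H (Z ∪ Q))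
    (hpq : p = q ∨ H.Adj p q ∧ Disjoint (L p) (L q)) (hpne : (L p).Nonempty)
    (hqne : (L q).Nonempty)
    (hbig : ∀ v ∈ U \ Q, v ≠ p → v ≠ q → 4 ≤ weight H D Z L v)
    (ψ : V → ℕ) (hψ : ∀ u ∈ Q, ∀ v ∈ Q, H.Adj u v → ψ u ≠ ψ v)
    (hO : ∀ y ∈ U \ Q, (y ∈ Nb H Z ∨ y = p ∨ y = q) → ∀ v ∈ Q, H.Adj y v → ψ v ∈ L y →
      ∃ r, (r = p ∨ r = q) ∧ H.Adj y r ∧ L r = {ψ v})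
    (hin : ∀ w ∈ U \ Q, w ∉ Nb H Z → w ≠ p → w ≠ q → ∀ v ∈ Q, ∀ v' ∈ Q, H.Adj w v →
      H.Adj w v' → ψ v = ψ v') :
    ∃ φ : V → ℕ, (∀ v ∈ U \ Q, φ v ∈ L v) ∧ (∀ v ∈ Q, φ v = ψ v) ∧
      ∀ u ∈ U, ∀ v ∈ U, H.Adj u v → φ u ≠ φ v := by
  classical
  let out : V → Prop := fun v => v ∈ Nb H Z ∨ v = p ∨ v = q
  let L' : V → Finset ℕ := fun v => if out v then L v else
    if h : ∃ u ∈ Q, H.Adj v u then (L v).erase (ψ h.choose) else L v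
  have hsub : ∀ v, L' v ⊆ L v := by
    intro v
    simp only [L']
    split_ifs
    · exact subset_rfl
    · exact Finset.erase_subset _ _
    · exact subset_rfl
  have hout : ∀ v, out v → L' v = L v := fun v h => by simp only [L', h, if_true]
  have hLp : L' p = L p := hout p (Or.inr (Or.inl rfl))
  have hLq : L' q = L q := hout q (Or.inr (Or.inr rfl))
  have hI : Inst H D (Z ∪ Q) (U \ Q) p q L' := by
    refine ⟨hZ.union_of_forall fun b hb => hQO hb, ?_, hp, hq, hpO, hqO, ?_, ?_, ?_, ?_⟩
    · rw [Set.disjoint_union_left]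
      exact ⟨hdisj.mono_right Set.sdiff_subset, Set.disjoint_sdiff_right⟩
    · rw [hLp, hLq]; exact hpq
    · rwa [hLp]
    · rwa [hLq]
    · intro v hv hvp hvq
      refine weight_le_of L' (hbig v hv hvp hvq) (fun h1 => ?_) fun h1 => ?_
      · exact ⟨Nb_mono Set.subset_union_left h1, by rw [hout v (Or.inl h1)]⟩
      · have hno : ¬ out v := by rintro (h | h | h) <;> contradiction
        by_cases hx : ∃ u ∈ Q, H.Adj v u
        · refine Or.inr ⟨?_, ?_⟩
          · obtain ⟨u, hu, hvu⟩ := hx; exact ⟨u, Or.inr hu, hvu.symm⟩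
          · simp only [L', hno, hx, if_false, dif_pos]
            have := Finset.pred_card_le_card_erase (s := L v) (a := ψ hx.choose)
            omega
        · exact Or.inl (by simp only [L', hno, hx, if_false, dif_neg, not_false_eq_true, le_refl])
  obtain ⟨φ, h1, h2⟩ := hT _ _ _ _ _ hn hI
  have key : ∀ y ∈ U \ Q, ∀ v ∈ Q, H.Adj y v → φ y ≠ ψ v := by
    intro y hy v hv hyv heq
    by_cases ho : out y
    · have h3 := h1 y hy
      rw [hout y ho, heq] at h3
      obtain ⟨r, hr, hyr, hLr⟩ := hO y hy ho v hv hyv h3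
      have hrU : r ∈ U \ Q := by rcases hr with rfl | rfl <;> assumption
      have h4 := hsub r (h1 r hrU)
      rw [hLr, Finset.mem_singleton] at h4
      exact h2 y hy r hrU hyr (heq.trans h4.symm)
    · have hx : ∃ u ∈ Q, H.Adj y u := ⟨v, hv, hyv⟩
      have h3 := h1 y hy
      simp only [L', ho, hx, if_false, dif_pos] at h3
      refine Finset.ne_of_mem_erase h3 (heq.trans ?_)
      exact hin y hy (fun h => ho (Or.inl h)) (fun h => ho (Or.inr (Or.inl h)))
        (fun h => ho (Or.inr (Or.inr h))) v hv _ hx.choose_spec.1 hyv hx.choose_spec.2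
  refine ⟨fun v => if v ∈ Q then ψ v else φ v, fun v hv => ?_, fun v hv => by simp [hv],
    fun u hu v hv huv => ?_⟩
  · simpa [hv.2] using hsub v (h1 v hv)
  · by_cases a : u ∈ Q <;> by_cases b : v ∈ Q <;> simp only [a, b, if_true, if_false]
    · exact hψ u a v b huv
    · exact (key v ⟨hv, b⟩ u a huv.symm).symm
    · exact key u ⟨hu, a⟩ v b huv
    · exact h2 u ⟨hu, a⟩ v ⟨hv, b⟩ huv

end PlanarChoice

namespace PlanarChoice

lemma exists_mem_notMem_of_card {s t : Finset ℕ} (h : t.card < s.card) : ∃ x ∈ s, x ∉ t :=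
  Finset.exists_mem_notMem_of_card_lt_card h

/-- A path whose lists have size at least three can be coloured from its last vertex backwards
so that each vertex avoids one further colour `f k`, except for the last, which avoids a set of
size at most two. -/
lemma greedy (E : ℕ → Finset ℕ) (f : ℕ → ℕ) (T : Finset ℕ) (hT : T.card ≤ 2) (a b : ℕ)
    (hab : a ≤ b) (hE : ∀ k, a ≤ k → k ≤ b → 3 ≤ (E k).card) :
    ∃ c : ℕ → ℕ, (∀ k, a ≤ k → k ≤ b → c k ∈ E k) ∧ (∀ k, a ≤ k → k < b → c k ≠ c (k + 1)) ∧
      c b ∉ T ∧ ∀ k, a ≤ k → k < b → c k ≠ f k := by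
  obtain ⟨m, rfl⟩ := Nat.exists_eq_add_of_le hab
  induction m generalizing a with
  | zero =>
    obtain ⟨x, hx, hxT⟩ := exists_mem_notMem_of_card (s := E a) (t := T)
      (by have := hE a le_rfl le_rfl; omega)
    exact ⟨fun _ => x, fun k h1 h2 => by obtain rfl : k = a := by omega
                                         exact hx, fun k h1 h2 => by omega, hxT,
      fun k h1 h2 => by omega⟩
  | succ m ih =>
    obtain ⟨c, h1, h2, h3, h4⟩ := ih (a + 1) (by omega) (fun k hk hk' => hE k (by omega) (by omega))
    obtain ⟨x, hx, hxT⟩ := exists_mem_notMem_of_card (s := E a) (t := {c (a + 1), f a})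
      (by have := hE a le_rfl (by omega)
          have := Finset.card_le_two (a := c (a + 1)) (b := f a); omega)
    simp only [Finset.mem_insert, Finset.mem_singleton, not_or] at hxT
    refine ⟨fun k => if k = a then x else c k, fun k hk hk' => ?_, fun k hk hk' => ?_, ?_,
      fun k hk hk' => ?_⟩
    · by_cases h : k = a
      · subst h; simpa using hx
      · simpa [h] using h1 k (by omega) (by omega)
    · by_cases h : k = a
      · subst h; simpa using hxT.1
      · have : k + 1 ≠ a := by omega
        simpa [h, this] using h2 k (by omega) (by omega)
    · have : a + (m + 1) ≠ a := by omega
      have e : a + (m + 1) = a + 1 + m := by omega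
      simp only [this, if_false]
      rw [e]; exact h3
    · by_cases h : k = a
      · subst h; simpa using hxT.2
      · simpa [h] using h4 k (by omega) (by omega)

/-- The choice of an initial piece of the boundary path that can be coloured and removed. -/
lemma exists_piece (n s c0 : ℕ) (E : ℕ → Finset ℕ) (d : ℕ → Prop) (W : ℕ → ℕ → Prop)
    (hsn : s ≤ n) (hds : ¬ d s)
    (hE3 : ∀ k, s ≤ k → k ≤ n → ¬ d k → (E k).card = 3)
    (hE2 : ∀ k, s ≤ k → k ≤ n → d k → (E k).card = 2)
    (hEn : (E (n + 1)).card ≤ 1)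
    (hdd : ∀ k, s ≤ k → k < n → d k → ¬ d (k + 1))
    (hW2 : ∀ i j, s ≤ i → i < j → j ≤ n → W i j → i + 2 ≤ j)
    (hWC : ∀ i j, s ≤ i → i < j → j ≤ n → W i j → ∃ k, i < k ∧ k < j ∧ d k)
    (hWC' : ∀ i, s ≤ i → i + 3 ≤ n → ¬ d i → d (i + 1) → ¬ d (i + 2) → ¬ d (i + 3) →
      ¬ W i (i + 3)) :
    ∃ (a b : ℕ) (c : ℕ → ℕ), s ≤ a ∧ a ≤ b ∧ b ≤ n ∧ (∀ k, a ≤ k → k ≤ b → c k ∈ E k) ∧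
      (∀ k, a ≤ k → k < b → c k ≠ c (k + 1)) ∧ c b ∉ E (b + 1) ∧
      (a = s ∧ c s ≠ c0 ∨ s < a ∧ c a ∉ E (a - 1)) ∧
      ∀ i j, a ≤ i → i < j → j ≤ b → W i j → c i = c j := by
  classical
  have run : ∀ u, s ≤ u → u ≤ n → ¬ d u → ∃ t, u ≤ t ∧ t ≤ n ∧ (∀ k, u ≤ k → k ≤ t → ¬ d k) ∧
      (E (t + 1)).card ≤ 2 ∧ (t < n → d (t + 1)) := by
    intro u hu hun hdu
    obtain ⟨m, rfl⟩ := Nat.exists_eq_add_of_le hun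
    have hex : ∃ k, u + k = u + m ∨ d (u + k + 1) := ⟨m, Or.inl rfl⟩
    have hspec := Nat.find_spec hex
    have hmin := fun k (hk : k < Nat.find hex) => Nat.find_min hex hk
    have hle : Nat.find hex ≤ m := Nat.find_min' hex (Or.inl rfl)
    generalize Nat.find hex = t at *
    refine ⟨u + t, by omega, by omega, fun k hk hk' => ?_, ?_, ?_⟩
    · obtain ⟨i, rfl⟩ := Nat.exists_eq_add_of_le hk
      cases i with
      | zero => exact hdu
      | succ i => exact fun h => hmin i (by omega) (Or.inr h)
    · by_cases h : t = m
      · subst h; omega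
      · rw [hE2 _ (by omega) (by omega) (hspec.resolve_left (by omega))]
    · intro h; exact hspec.resolve_left (by omega)
  obtain ⟨t, hst, htn, htd, htE, htd'⟩ := run s le_rfl hsn hds
  by_cases hts : s < t
  · obtain ⟨c, h1, h2, h3, h4⟩ := greedy E (fun _ => c0) _ htE s t hst
      (fun k hk hk' => (hE3 k hk (by omega) (htd k hk hk')).ge)
    exact ⟨s, t, c, le_rfl, hst, htn, h1, h2, h3, Or.inl ⟨rfl, h4 s le_rfl hts⟩,
      fun i j hi hij hj hw => by
        obtain ⟨k, hk1, hk2, hk⟩ := hWC i j hi hij (by omega) hw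
        exact absurd hk (htd k (by omega) (by omega))⟩
  obtain rfl : t = s := by omega
  have hEs := hE3 t le_rfl hsn hds
  have hEs' : 2 ≤ ((E t).erase c0).card := by
    have := Finset.pred_card_le_card_erase (s := E t) (a := c0); omega
  by_cases hfree : ∃ x ∈ (E t).erase c0, x ∉ E (t + 1)
  · obtain ⟨x, hx, hx'⟩ := hfree
    exact ⟨t, t, fun _ => x, le_rfl, le_rfl, hsn,
      fun k h1 h2 => by obtain rfl : k = t := by omega
                        exact Finset.mem_of_mem_erase hx,
      fun k h1 h2 => by omega, hx', Or.inl ⟨rfl, Finset.ne_of_mem_erase hx⟩,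
      fun i j _ _ _ => by omega⟩
  push Not at hfree
  have hsub : (E t).erase c0 ⊆ E (t + 1) := hfree
  have htn1 : t + 1 ≤ n := by
    by_contra h
    obtain rfl : t = n := by omega
    have := Finset.card_le_card hsub
    omega
  have hdx : d (t + 1) := htd' (by omega)
  have hEx := hE2 (t + 1) (by omega) htn1 hdx
  have heq : (E t).erase c0 = E (t + 1) := Finset.eq_of_subset_of_card_le hsub (by omega)
  obtain ⟨α, β, hαβ, hab⟩ := Finset.card_eq_two.1 hEx
  have hmemt : ∀ x ∈ E (t + 1), x ∈ E t ∧ x ≠ c0 := fun x hx => by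
    rw [← heq] at hx; exact ⟨Finset.mem_of_mem_erase hx, Finset.ne_of_mem_erase hx⟩
  have other : ∀ x ∈ E (t + 1), ∃ y ∈ E (t + 1), y ≠ x := by
    intro x hx
    obtain ⟨y, hy, hyx⟩ := exists_mem_notMem_of_card (s := E (t + 1)) (t := {x}) (by simp [hEx])
    exact ⟨y, hy, by simpa using hyx⟩
  by_cases hfree2 : ∃ x ∈ E (t + 1), x ∉ E (t + 2)
  · obtain ⟨x, hx, hx'⟩ := hfree2
    obtain ⟨y, hy, hyx⟩ := other x hx
    refine ⟨t, t + 1, fun k => if k = t then y else x, le_rfl, by omega, htn1, fun k h1 h2 => ?_,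
      fun k h1 h2 => ?_, by simpa using hx', Or.inl ⟨rfl, by simpa using (hmemt y hy).2⟩,
      fun i j h1 h2 h3 hw => ?_⟩
    · obtain rfl | rfl : k = t ∨ k = t + 1 := by omega
      · simpa using (hmemt y hy).1
      · simpa using hx
    · obtain rfl : k = t := by omega
      simpa using hyx
    · have := hW2 i j (by omega) h2 (by omega) hw; omega
  push Not at hfree2
  have hsub2 : E (t + 1) ⊆ E (t + 2) := hfree2
  have htn2 : t + 2 ≤ n := by
    by_contra h
    obtain rfl : t + 1 = n := by omega
    have := Finset.card_le_card hsub2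
    have e : t + 1 + 1 = t + 2 := rfl
    rw [e] at hEn
    omega
  have hdu : ¬ d (t + 2) := hdd (t + 1) (by omega) (by omega) hdx
  have hEu := hE3 (t + 2) (by omega) htn2 hdu
  obtain ⟨δ, hδ, hδ'⟩ := exists_mem_notMem_of_card (s := E (t + 2)) (t := E (t + 1)) (by omega)
  have hEu' : E (t + 2) = insert δ (E (t + 1)) :=
    (Finset.eq_of_subset_of_card_le (Finset.insert_subset hδ hsub2)
      (by rw [Finset.card_insert_of_notMem hδ']; omega)).symm
  /- colouring three vertices alternately -/
  have alt : ∀ x ∈ E (t + 1), x ∉ E (t + 3) → ∃ (a b : ℕ) (c : ℕ → ℕ), t ≤ a ∧ a ≤ b ∧ b ≤ n ∧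
      (∀ k, a ≤ k → k ≤ b → c k ∈ E k) ∧
      (∀ k, a ≤ k → k < b → c k ≠ c (k + 1)) ∧ c b ∉ E (b + 1) ∧
      (a = t ∧ c t ≠ c0 ∨ t < a ∧ c a ∉ E (a - 1)) ∧
      ∀ i j, a ≤ i → i < j → j ≤ b → W i j → c i = c j := by
    intro x hx hx'
    obtain ⟨y, hy, hyx⟩ := other x hx
    refine ⟨t, t + 2, fun k => if k = t + 1 then y else x, le_rfl, by omega, htn2,
      fun k h1 h2 => ?_, fun k h1 h2 => ?_, by simpa using hx',
      Or.inl ⟨rfl, by simpa using (hmemt x hx).2⟩, fun i j h1 h2 h3 hw => ?_⟩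
    · obtain rfl | rfl | rfl : k = t ∨ k = t + 1 ∨ k = t + 2 := by omega
      · simpa using (hmemt x hx).1
      · simpa using hy
      · simpa using hsub2 hx
    · obtain rfl | rfl : k = t ∨ k = t + 1 := by omega
      · simpa using hyx.symm
      · simpa using hyx
    · have := hW2 i j (by omega) h2 (by omega) hw
      obtain rfl : i = t := by omega
      obtain rfl : j = i + 2 := by omega
      simp
  obtain ⟨r, htr, hrn, hrd, hrE, hrd'⟩ := run (t + 2) (by omega) htn2 hdu
  by_cases hr2 : r = t + 2
  · subst hr2
    by_cases hδr : δ ∈ E (t + 3)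
    · obtain ⟨x, hx, hx'⟩ := exists_mem_notMem_of_card (s := E (t + 1)) (t := (E (t + 3)).erase δ)
        (by rw [Finset.card_erase_of_mem hδr]
            have e : t + 2 + 1 = t + 3 := rfl
            rw [e] at hrE
            have : 0 < (E (t + 3)).card := Finset.card_pos.2 ⟨_, hδr⟩
            omega)
      refine alt x hx fun h => hx' (Finset.mem_erase.2 ⟨?_, h⟩)
      rintro rfl; exact hδ' hx
    · exact ⟨t + 2, t + 2, fun _ => δ, by omega, le_rfl, htn2,
        fun k h1 h2 => by obtain rfl : k = t + 2 := by omega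
                          exact hδ,
        fun k h1 h2 => by omega, hδr, Or.inr ⟨by omega, hδ'⟩, fun i j _ _ _ => by omega⟩
  by_cases hr3 : r = t + 3
  · subst hr3
    have hd3 : ¬ d (t + 3) := hrd _ (by omega) le_rfl
    have hE3' := hE3 (t + 3) (by omega) hrn hd3
    by_cases hf : ∃ x ∈ E (t + 3), x ∉ E (t + 4) ∧ x ≠ δ
    · obtain ⟨x, hx, hx', hxδ⟩ := hf
      refine ⟨t + 2, t + 3, fun k => if k = t + 2 then δ else x, by omega, by omega, hrn,
        fun k h1 h2 => ?_, fun k h1 h2 => ?_, by simpa using hx',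
        Or.inr ⟨by omega, by simpa using hδ'⟩, fun i j h1 h2 h3 hw => ?_⟩
      · obtain rfl | rfl : k = t + 2 ∨ k = t + 3 := by omega
        · simpa using hδ
        · simpa using hx
      · obtain rfl : k = t + 2 := by omega
        simpa using hxδ.symm
      · have := hW2 i j (by omega) h2 (by omega) hw; omega
    push Not at hf
    obtain ⟨x, hx, hx4⟩ := exists_mem_notMem_of_card (s := E (t + 3)) (t := E (t + 4))
      (by have e : t + 3 + 1 = t + 4 := rfl
          rw [e] at hrE; omega)
    obtain rfl := hf x hx hx4
    by_cases hα : α ∈ E (t + 3) ∧ β ∈ E (t + 3)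
    · have hα1 : α ∈ E (t + 1) := by rw [hab]; simp
      have hβ1 : β ∈ E (t + 1) := by rw [hab]; simp
      have hxα : x ≠ α := by rintro rfl; exact hδ' hα1
      refine ⟨t, t + 3, fun k => if k = t + 3 then x else if k = t + 1 then β else α, le_rfl,
        by omega, hrn, fun k h1 h2 => ?_, fun k h1 h2 => ?_, by simpa using hx4,
        Or.inl ⟨rfl, by simpa using (hmemt α hα1).2⟩, fun i j h1 h2 h3 hw => ?_⟩
      · obtain rfl | rfl | rfl | rfl : k = t ∨ k = t + 1 ∨ k = t + 2 ∨ k = t + 3 := by omega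
        · simpa using (hmemt α hα1).1
        · simpa using hβ1
        · simpa using hsub2 hα1
        · simpa using hx
      · obtain rfl | rfl | rfl : k = t ∨ k = t + 1 ∨ k = t + 2 := by omega
        · simpa using hαβ
        · simpa using hαβ.symm
        · simpa using hxα.symm
      · have := hW2 i j (by omega) h2 (by omega) hw
        by_cases hi : i = t + 1
        · subst hi
          obtain rfl : j = t + 3 := by omega
          obtain ⟨k, hk1, hk2, hk⟩ := hWC _ _ (by omega) h2 (by omega) hw
          obtain rfl : k = t + 2 := by omega
          exact absurd hk hdu
        · obtain rfl : i = t := by omega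
          by_cases hj : j = i + 3
          · subst hj; exact absurd hw (hWC' i le_rfl hrn hds hdx hdu hd3)
          · obtain rfl : j = i + 2 := by omega
            simp
    · rw [not_and_or] at hα
      rcases hα with h | h
      · exact alt α (by rw [hab]; simp) h
      · exact alt β (by rw [hab]; simp) h
  · obtain ⟨c, h1, h2, h3, h4⟩ := greedy E (fun _ => δ) _ hrE (t + 3) r (by omega)
      (fun k hk hk' => (hE3 k (by omega) (by omega) (hrd k (by omega) hk')).ge)
    refine ⟨t + 2, r, fun k => if k = t + 2 then δ else c k, by omega, htr, hrn,
      fun k hk hk' => ?_, fun k hk hk' => ?_, by simpa [hr2] using h3,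
      Or.inr ⟨by omega, by simpa using hδ'⟩, fun i j hi hij hj hw => ?_⟩
    · by_cases h : k = t + 2
      · subst h; simpa using hδ
      · simpa [h] using h1 k (by omega) hk'
    · by_cases h : k = t + 2
      · subst h; simpa using (h4 (t + 3) le_rfl (by omega)).symm
      · have : k ≠ t + 1 := by omega
        simpa [h, this] using h2 k (by omega) hk'
    · obtain ⟨k, hk1, hk2, hk⟩ := hWC i j (by omega) hij (by omega) hw
      exact absurd hk (hrd k (by omega) (by omega))

end PlanarChoice

namespace PlanarChoice

variable {V : Type} {H : SimpleGraph V} {Z U : Set V} {y : ℕ → V}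

/-- The connectivity assumptions left after the decomposition steps. -/
structure Core (H : SimpleGraph V) (Z U : Set V) : Prop where
  k5 : NoK5 H
  k33 : NoK33 H
  connZ : Conn H Z
  disj : Disjoint Z U
  conn : PreConn H U
  nocut : ∀ c ∈ U, PreConn H (U \ {c})
  nosep : ∀ u ∈ U, ∀ v ∈ U, u ∈ Nb H Z → v ∈ Nb H Z → H.Adj u v → PreConn H (U \ {u, v})

lemma conn_image_Icc {a b : ℕ} (hab : a ≤ b)
    (h : ∀ k, a ≤ k → k < b → H.Adj (y k) (y (k + 1))) : Conn H (y '' Set.Icc a b) := by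
  obtain ⟨m, rfl⟩ := Nat.exists_eq_add_of_le hab
  induction m with
  | zero => simpa using conn_singleton (y a)
  | succ m ih =>
    have e : y '' Set.Icc a (a + (m + 1)) = y '' Set.Icc a (a + m) ∪ {y (a + m + 1)} := by
      ext v
      simp only [Set.mem_image, Set.mem_Icc, Set.mem_union, Set.mem_singleton_iff]
      constructor
      · rintro ⟨k, hk, rfl⟩
        by_cases hk' : k = a + m + 1
        · subst hk'; exact Or.inr rfl
        · exact Or.inl ⟨k, by omega, rfl⟩
      · rintro (⟨k, hk, rfl⟩ | rfl)
        · exact ⟨k, by omega, rfl⟩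
        · exact ⟨a + m + 1, by omega, rfl⟩
    rw [e]
    refine (ih (by omega) fun k h1 h2 => h k h1 (by omega)).union (conn_singleton _) ?_
    exact ⟨y (a + m), ⟨a + m, by simp, rfl⟩, _, rfl, h (a + m) (by omega) (by omega)⟩

/-- A path along the boundary whose ends have a common inner neighbour `w`. -/
structure Pocket (H : SimpleGraph V) (Z U : Set V) (y : ℕ → V) (i j : ℕ) (w : V) : Prop where
  le : i + 2 ≤ j
  mem : ∀ k, i ≤ k → k ≤ j → y k ∈ U
  nb : ∀ k, i ≤ k → k ≤ j → y k ∈ Nb H Z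
  inj : ∀ k l, i ≤ k → k ≤ j → i ≤ l → l ≤ j → y k = y l → k = l
  adj : ∀ k, i ≤ k → k < j → H.Adj (y k) (y (k + 1))
  wU : w ∈ U
  wO : w ∉ Nb H Z
  wi : H.Adj w (y i)
  wj : H.Adj w (y j)

variable {i j : ℕ} {w : V}

lemma Pocket.reverse (P : Pocket H Z U y i j w) :
    Pocket H Z U (fun k => y (i + j - k)) i j w where
  le := P.le
  mem k h1 h2 := P.mem _ (by omega) (by omega)
  nb k h1 h2 := P.nb _ (by omega) (by omega)
  inj k l h1 h2 h3 h4 h := by have := P.inj _ _ (by omega) (by omega) (by omega) (by omega) h; omega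
  adj k h1 h2 := by
    have := P.adj (i + j - (k + 1)) (by omega) (by omega)
    have e : i + j - (k + 1) + 1 = i + j - k := by omega
    rw [e] at this
    exact this.symm
  wU := P.wU
  wO := P.wO
  wi := by simpa using P.wj
  wj := by simpa using P.wi

lemma Pocket.ne (P : Pocket H Z U y i j w) (k : ℕ) (h1 : i ≤ k) (h2 : k ≤ j) : y k ≠ w := by
  rintro rfl; exact P.wO (P.nb k h1 h2)

lemma Pocket.no_side_component (P : Pocket H Z U y i j w) (C : Core H Z U) {Y : Set V}
    (hY : Conn H Y) (hYU : Y ⊆ U) (hYy : ∀ k, i ≤ k → k ≤ j → y k ∉ Y) (hwY : w ∉ Y)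
    (hYZ : ∃ a ∈ Y, a ∈ Nb H Z)
    (hN : ∀ a ∈ Y, ∀ b ∈ U, H.Adj a b → b ∈ Y ∨ ∃ k, i < k ∧ k ≤ j ∧ b = y k) : False := by
  have hij := P.le
  have hyi := hYy i le_rfl (by omega)
  have hyiU := P.mem i le_rfl (by omega)
  let T : Set ℕ := {k | i < k ∧ k ≤ j ∧ ∃ a ∈ Y, H.Adj a (y k)}
  have hTfin : T.Finite := (Set.finite_Iic j).subset fun k hk => hk.2.1
  have hTne : T.Nonempty := by
    obtain ⟨a, ha, b, hb, hbY, hab⟩ := C.conn.touch hYU hY.1 hyiU hyi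
    rcases hN a ha b hb hab with h | ⟨k, h1, h2, rfl⟩
    · exact absurd h hbY
    · exact ⟨k, h1, h2, a, ha, hab⟩
  obtain ⟨s, ⟨hs1, hs2, hsY⟩, hsmin⟩ := Set.exists_min_image T id hTfin hTne
  obtain ⟨t, ⟨ht1, ht2, htY⟩, htmax⟩ := Set.exists_max_image T id hTfin hTne
  simp only [id] at hsmin htmax
  have hN' : ∀ a ∈ Y, ∀ b ∈ U, H.Adj a b → b ∈ Y ∨ ∃ k, s ≤ k ∧ k ≤ t ∧ b = y k := by
    intro a ha b hb hab
    rcases hN a ha b hb hab with h | ⟨k, h1, h2, rfl⟩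
    · exact Or.inl h
    · have hk : k ∈ T := ⟨h1, h2, a, ha, hab⟩
      exact Or.inr ⟨k, hsmin k hk, htmax k hk, rfl⟩
  have hst : s ≤ t := hsmin t ⟨ht1, ht2, htY⟩
  have hne : ∀ k, i < k → k ≤ j → y i ≠ y k := fun k h1 h2 h => by
    have := P.inj i k le_rfl (by omega) (by omega) h2 h; omega
  by_cases h0 : s = t
  · subst h0
    have := C.nocut (y s) (P.mem s (by omega) hs2) Y
      (fun a ha => ⟨hYU ha, fun h => hYy s (by omega) hs2 (h ▸ ha)⟩) hY.1
      (fun a ha b hb hab => by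
        rcases hN' a ha b hb.1 hab with h | ⟨k, h1, h2, rfl⟩
        · exact h
        · obtain rfl : k = s := by omega
          exact absurd rfl hb.2)
    exact hyi (this ▸ ⟨hyiU, hne s hs1 hs2⟩)
  by_cases h1 : t = s + 1
  · subst h1
    have := C.nosep (y s) (P.mem s (by omega) hs2) (y (s + 1)) (P.mem _ (by omega) ht2)
      (P.nb s (by omega) hs2) (P.nb _ (by omega) ht2) (P.adj s (by omega) (by omega)) Y
      (fun a ha => ⟨hYU ha, by
        rintro (rfl | rfl)
        · exact hYy s (by omega) hs2 ha
        · exact hYy (s + 1) (by omega) ht2 ha⟩) hY.1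
      (fun a ha b hb hab => by
        rcases hN' a ha b hb.1 hab with h | ⟨k, h1, h2, rfl⟩
        · exact h
        · obtain rfl | rfl : k = s ∨ k = s + 1 := by omega
          · exact absurd (Or.inl rfl) hb.2
          · exact absurd (Or.inr rfl) hb.2)
    refine hyi (this ▸ ⟨hyiU, ?_⟩)
    rintro (h | h)
    · exact hne s hs1 hs2 h
    · exact hne (s + 1) (by omega) ht2 h
  have hsucc : t - 1 + 1 = t := by omega
  have hM : Conn H (y '' Set.Icc (s + 1) (t - 1)) :=
    conn_image_Icc (by omega) fun k h1 h2 => P.adj k (by omega) (by omega)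
  let R : Set V := (y '' Set.Icc i (s - 1) ∪ {w}) ∪ {v | ∃ k, t < k ∧ k ≤ j ∧ v = y k}
  have hR1 : Conn H (y '' Set.Icc i (s - 1) ∪ {w}) :=
    (conn_image_Icc (by omega) fun k h1 h2 => P.adj k (by omega) (by omega)).union
      (conn_singleton w) ⟨y i, ⟨i, ⟨le_rfl, by omega⟩, rfl⟩, w, rfl, P.wi.symm⟩
  have hR : Conn H R := by
    by_cases htj : t = j
    · have : {v | ∃ k, t < k ∧ k ≤ j ∧ v = y k} = (∅ : Set V) := by
        ext v; simp only [Set.mem_ofPred_eq, Set.mem_empty_iff_false, iff_false]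
        rintro ⟨k, h1, h2, -⟩; omega
      simp only [R, this, Set.union_empty]; exact hR1
    · have : {v | ∃ k, t < k ∧ k ≤ j ∧ v = y k} = y '' Set.Icc (t + 1) j := by
        ext v; simp only [Set.mem_ofPred_eq, Set.mem_image, Set.mem_Icc]
        constructor
        · rintro ⟨k, h1, h2, rfl⟩; exact ⟨k, by omega, rfl⟩
        · rintro ⟨k, h1, rfl⟩; exact ⟨k, by omega, by omega, rfl⟩
      simp only [R, this]
      refine hR1.union (conn_image_Icc (by omega) fun k h1 h2 => P.adj k (by omega) (by omega)) ?_
      exact ⟨w, Or.inr rfl, y j, ⟨j, ⟨by omega, le_rfl⟩, rfl⟩, P.wj⟩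
  have hRU : R ⊆ U := by
    rintro v ((⟨k, hk, rfl⟩ | rfl) | ⟨k, h1, h2, rfl⟩)
    · exact P.mem k hk.1 (by have := hk.2; omega)
    · exact P.wU
    · exact P.mem k (by omega) h2
  have hMU : y '' Set.Icc (s + 1) (t - 1) ⊆ U := by
    rintro v ⟨k, hk, rfl⟩
    exact P.mem k (by have := hk.1; omega) (by have := hk.2; omega)
  have hyR : ∀ k, s ≤ k → k ≤ t → y k ∉ R := by
    rintro k h1 h2 ((⟨l, hl, h⟩ | h) | ⟨l, h3, h4, h⟩)
    · have h5 := hl.1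
      have h6 := hl.2
      have := P.inj l k hl.1 (by omega) (by omega) (by omega) h
      omega
    · exact P.ne k (by omega) (by omega) h
    · have := P.inj k l (by omega) (by omega) (by omega) (by omega) h
      omega
  have hZ : ∀ {A : Set V}, A ⊆ U → Disjoint A Z := fun h => (C.disj.mono_right h).symm
  have hsU : {y s} ⊆ U := Set.singleton_subset_iff.2 (P.mem s (by omega) hs2)
  have htU : {y t} ⊆ U := Set.singleton_subset_iff.2 (P.mem t (by omega) ht2)
  have tZ : ∀ {A : Set V}, (∃ a ∈ A, a ∈ Nb H Z) → Touch H Z A := by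
    rintro A ⟨a, ha, z, hz, hza⟩
    exact ⟨z, hz, a, ha, hza⟩
  have hsM : ∀ k, k = s ∨ k = t → y k ∉ y '' Set.Icc (s + 1) (t - 1) := by
    rintro k hk ⟨l, hl, h⟩
    have h5 := hl.1
    have h6 := hl.2
    have := P.inj l k (by omega) (by omega) (by omega) (by omega) h
    omega
  refine C.k33.elim (conn_singleton (y s)) (conn_singleton (y t)) C.connZ hM hY hR
    ?_ (hZ hsU) (hZ htU) ?_ ?_ ?_ ?_ ?_ ?_ ?_ ?_ ?_ (hZ hMU).symm (hZ hYU).symm (hZ hRU).symm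
    ?_ ?_ ?_ ?_ ?_ ?_ ?_ ?_ ?_
  · exact Set.disjoint_singleton.2 fun h => h0 (P.inj s t (by omega) hs2 (by omega) ht2 h)
  · rw [Set.disjoint_left]
    rintro v ⟨k, hk, rfl⟩
    exact hYy k (by have := hk.1; omega) (by have := hk.2; omega)
  · rw [Set.disjoint_left]
    rintro v ⟨k, hk, rfl⟩
    exact hyR k (by have := hk.1; omega) (by have := hk.2; omega)
  · rw [Set.disjoint_right]
    rintro v ((⟨k, hk, rfl⟩ | rfl) | ⟨k, h1, h2, rfl⟩)
    · exact hYy k hk.1 (by have := hk.2; omega)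
    · exact hwY
    · exact hYy k (by omega) h2
  · exact Set.disjoint_singleton_left.2 (hsM s (Or.inl rfl))
  · exact Set.disjoint_singleton_left.2 (hYy s (by omega) hs2)
  · exact Set.disjoint_singleton_left.2 (hyR s le_rfl hst)
  · exact Set.disjoint_singleton_left.2 (hsM t (Or.inr rfl))
  · exact Set.disjoint_singleton_left.2 (hYy t (by omega) ht2)
  · exact Set.disjoint_singleton_left.2 (hyR t hst le_rfl)
  · exact ⟨_, rfl, y (s + 1), ⟨s + 1, ⟨le_rfl, by omega⟩, rfl⟩, P.adj s (by omega) (by omega)⟩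
  · obtain ⟨a, ha, h⟩ := hsY
    exact ⟨_, rfl, a, ha, h.symm⟩
  · refine ⟨_, rfl, y (s - 1), Or.inl (Or.inl ⟨s - 1, ⟨by omega, le_rfl⟩, rfl⟩), ?_⟩
    have := P.adj (s - 1) (by omega) (by omega)
    rw [show s - 1 + 1 = s by omega] at this
    exact this.symm
  · refine ⟨_, rfl, y (t - 1), ⟨t - 1, ⟨by omega, le_rfl⟩, rfl⟩, ?_⟩
    have := P.adj (t - 1) (by omega) (by omega)
    rw [hsucc] at this
    exact this.symm
  · obtain ⟨a, ha, h⟩ := htY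
    exact ⟨_, rfl, a, ha, h.symm⟩
  · by_cases htj : t = j
    · subst htj; exact ⟨_, rfl, w, Or.inl (Or.inr rfl), P.wj.symm⟩
    · exact ⟨_, rfl, y (t + 1), Or.inr ⟨t + 1, by omega, by omega, rfl⟩,
        P.adj t (by omega) (by omega)⟩
  · exact tZ ⟨y (s + 1), ⟨s + 1, ⟨le_rfl, by omega⟩, rfl⟩, P.nb _ (by omega) (by omega)⟩
  · exact tZ hYZ
  · exact tZ ⟨y i, Or.inl (Or.inl ⟨i, ⟨le_rfl, by omega⟩, rfl⟩), P.nb i le_rfl (by omega)⟩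

/-- The pocket cut off by `y i`, `w`, `y j` meets the boundary only in the path. -/
lemma Pocket.boundary (P : Pocket H Z U y i j w) (C : Core H Z U) {o : V}
    (ho : o ∈ comp H (U \ {y i, w, y j}) (y (i + 1))) (hoZ : o ∈ Nb H Z) :
    ∃ k, i < k ∧ k < j ∧ o = y k := by
  have hij := P.le
  by_contra hno
  push Not at hno
  set B : Set V := y '' Set.Icc (i + 1) (j - 1) with hB
  set K := comp H (U \ {y i, w, y j}) (y (i + 1)) with hK
  have hBconn : Conn H B :=
    conn_image_Icc (by omega) fun k h1 h2 => P.adj k (by omega) (by omega)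
  have hBsub : B ⊆ U \ {y i, w, y j} := by
    rintro v ⟨k, hk, rfl⟩
    have h1 := hk.1
    have h2 := hk.2
    refine ⟨P.mem k (by omega) (by omega), ?_⟩
    rintro (h | h | h)
    · have := P.inj _ _ (by omega) (by omega) (by omega) (by omega) h; omega
    · exact P.ne k (by omega) (by omega) h
    · have := P.inj _ _ (by omega) (by omega) (by omega) (by omega) h; omega
  have hy1B : y (i + 1) ∈ B := ⟨i + 1, ⟨le_rfl, by omega⟩, rfl⟩
  have hBK : B ⊆ K := hBconn.subset_comp hBsub hy1B
  have hKsub : K ⊆ U \ {y i, w, y j} := comp_subset (hBsub hy1B)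
  have hKconn : Conn H K := comp_conn (hBsub hy1B)
  have hoB : o ∉ B := by
    rintro ⟨k, hk, rfl⟩
    exact hno k (by have := hk.1; omega) (by have := hk.2; omega) rfl
  set S : Set V := (U \ {y i, w, y j}) \ B with hS
  have hoS : o ∈ S := ⟨hKsub ho, hoB⟩
  set Y := comp H S o with hYdef
  have hYS : Y ⊆ S := comp_subset hoS
  have hY : Conn H Y := comp_conn hoS
  have hYK : Y ⊆ K := by
    refine comp_subset_of_closed (fun a ha b hb hab => ?_) ho
    exact comp_closed a ha b hb.1 hab
  have hYU : Y ⊆ U := fun a ha => (hYS ha).1.1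
  have tBY : Touch H B Y := by
    obtain ⟨a, ha, b, hb, hbY, hab⟩ :=
      hKconn.2.touch hYK hY.1 (hBK hy1B) (fun h => (hYS h).2 hy1B)
    have : b ∈ B := by
      by_contra hbB
      exact hbY (comp_closed a ha b ⟨hKsub hb, hbB⟩ hab)
    exact ⟨b, this, a, ha, hab.symm⟩
  have hYi : y i ∉ Y := fun h => (hYS h).1.2 (Or.inl rfl)
  have hYw : w ∉ Y := fun h => (hYS h).1.2 (Or.inr (Or.inl rfl))
  have hYj : y j ∉ Y := fun h => (hYS h).1.2 (Or.inr (Or.inr rfl))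
  have hBi : y i ∉ B := fun h => (hBsub h).2 (Or.inl rfl)
  have hBw : w ∉ B := fun h => (hBsub h).2 (Or.inr (Or.inl rfl))
  have hBj : y j ∉ B := fun h => (hBsub h).2 (Or.inr (Or.inr rfl))
  have hZ : ∀ {A : Set V}, A ⊆ U → Disjoint Z A := fun h => C.disj.mono_right h
  have hiU : {y i} ⊆ U := Set.singleton_subset_iff.2 (P.mem i le_rfl (by omega))
  have hjU : {y j} ⊆ U := Set.singleton_subset_iff.2 (P.mem j (by omega) le_rfl)
  have hwU : {w} ⊆ U := Set.singleton_subset_iff.2 P.wU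
  have hBU : B ⊆ U := fun a ha => (hBsub ha).1
  have hij' : y i ≠ y j := fun h => by
    have := P.inj i j le_rfl (by omega) (by omega) le_rfl h; omega
  have hiw := P.ne i le_rfl (by omega)
  have hjw := P.ne j (by omega) le_rfl
  have tZ : ∀ {A : Set V}, (∃ a ∈ A, a ∈ Nb H Z) → Touch H Z A := by
    rintro A ⟨a, ha, z, hz, hza⟩
    exact ⟨z, hz, a, ha, hza⟩
  have tZi : Touch H Z {y i} := tZ ⟨_, rfl, P.nb i le_rfl (by omega)⟩
  have tZj : Touch H Z {y j} := tZ ⟨_, rfl, P.nb j (by omega) le_rfl⟩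
  have tZY : Touch H Z Y := tZ ⟨o, mem_comp_self, hoZ⟩
  have tZB : Touch H Z B := tZ ⟨_, hy1B, P.nb _ (by omega) (by omega)⟩
  have tBi : Touch H B {y i} := ⟨_, hy1B, _, rfl, (P.adj i le_rfl (by omega)).symm⟩
  have tBj : Touch H B {y j} := by
    refine ⟨y (j - 1), ⟨j - 1, ⟨by omega, le_rfl⟩, rfl⟩, _, rfl, ?_⟩
    have := P.adj (j - 1) (by omega) (by omega)
    rwa [show j - 1 + 1 = j by omega] at this
  have dBY : Disjoint B Y := Set.disjoint_right.2 fun a ha => (hYS ha).2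
  by_cases hw : Touch H {w} Y
  · exact C.k33.elim C.connZ hBconn (conn_singleton w) (conn_singleton (y i))
      (conn_singleton (y j)) hY (hZ hBU) (hZ hwU) (Set.disjoint_singleton_right.2 hBw)
      (Set.disjoint_singleton.2 hij') (Set.disjoint_singleton_left.2 hYi)
      (Set.disjoint_singleton_left.2 hYj) (hZ hiU) (hZ hjU) (hZ hYU)
      (Set.disjoint_singleton_right.2 hBi) (Set.disjoint_singleton_right.2 hBj) dBY
      (Set.disjoint_singleton.2 hiw.symm) (Set.disjoint_singleton.2 hjw.symm)
      (Set.disjoint_singleton_left.2 hYw) tZi tZj tZY tBi tBj tBY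
      ⟨_, rfl, _, rfl, P.wi⟩ ⟨_, rfl, _, rfl, P.wj⟩ hw
  have hNY : ∀ a ∈ Y, ∀ b ∈ U, H.Adj a b → b ∈ Y ∨ b = y i ∨ b = y j ∨ b ∈ B := by
    intro a ha b hb hab
    by_cases hbS : b ∈ S
    · exact Or.inl (comp_closed a ha b hbS hab)
    · right
      by_contra! hcon
      refine hbS ⟨⟨hb, ?_⟩, hcon.2.2⟩
      rintro (rfl | rfl | rfl)
      · exact hcon.1 rfl
      · exact hw ⟨_, rfl, a, ha, hab.symm⟩
      · exact hcon.2.1 rfl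
  have hYy : ∀ k, i ≤ k → k ≤ j → y k ∉ Y := by
    intro k h1 h2 h
    by_cases hki : k = i
    · exact hYi (hki ▸ h)
    by_cases hkj : k = j
    · exact hYj (hkj ▸ h)
    exact (hYS h).2 ⟨k, ⟨by omega, by omega⟩, rfl⟩
  by_cases hti : Touch H {y i} Y
  · by_cases htj : Touch H {y j} Y
    · refine C.k5.elim C.connZ hBconn ((conn_singleton (y i)).union (conn_singleton w)
        ⟨_, rfl, _, rfl, P.wi.symm⟩) (conn_singleton (y j)) hY (hZ hBU)
        (hZ (Set.union_subset hiU hwU)) (hZ hjU) (hZ hYU) ?_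
        (Set.disjoint_singleton_right.2 hBj) dBY ?_ ?_ (Set.disjoint_singleton_left.2 hYj)
        tZB (tZi.mono subset_rfl Set.subset_union_left) tZj tZY
        (tBi.mono subset_rfl Set.subset_union_left) tBj tBY
        ⟨w, Or.inr rfl, _, rfl, P.wj⟩ (hti.mono Set.subset_union_left subset_rfl) htj
      · rw [Set.disjoint_union_right]
        exact ⟨Set.disjoint_singleton_right.2 hBi, Set.disjoint_singleton_right.2 hBw⟩
      · rw [Set.disjoint_union_left]
        exact ⟨Set.disjoint_singleton.2 hij', Set.disjoint_singleton.2 hjw.symm⟩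
      · rw [Set.disjoint_union_left]
        exact ⟨Set.disjoint_singleton_left.2 hYi, Set.disjoint_singleton_left.2 hYw⟩
    · refine P.reverse.no_side_component C hY hYU
        (fun k h1 h2 => hYy _ (by omega) (by omega)) hYw ⟨o, mem_comp_self, hoZ⟩
        fun a ha b hb hab => ?_
      rcases hNY a ha b hb hab with h | rfl | rfl | ⟨k, hk, rfl⟩
      · exact Or.inl h
      · exact Or.inr ⟨j, by omega, le_rfl, by simp⟩
      · exact absurd ⟨_, rfl, a, ha, hab.symm⟩ htj
      · have h1 := hk.1
        have h2 := hk.2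
        exact Or.inr ⟨i + j - k, by omega, by omega,
          congrArg y (by omega)⟩
  · refine P.no_side_component C hY hYU hYy hYw ⟨o, mem_comp_self, hoZ⟩ fun a ha b hb hab => ?_
    rcases hNY a ha b hb hab with h | rfl | rfl | ⟨k, hk, rfl⟩
    · exact Or.inl h
    · exact absurd ⟨_, rfl, a, ha, hab.symm⟩ hti
    · exact Or.inr ⟨j, by omega, le_rfl, rfl⟩
    · exact Or.inr ⟨k, hk.1, by have := hk.2; omega, rfl⟩

end PlanarChoice

namespace PlanarChoice

variable {V : Type} {H : SimpleGraph V} {Z U : Set V}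

lemma exists_link {R : Set V} {u x y z : V} (hz : PreConn H (U \ {u, z}))
    (hR : ∀ v, v ∈ R ↔ v ∈ U ∧ v ≠ u ∧ v ≠ x ∧ v ≠ y ∧ v ≠ z)
    (hx : x ∈ U) (hy : y ∈ U) (hxu : x ≠ u) (hyu : y ≠ u) (hxz : x ≠ z) (hyz : y ≠ z)
    (hxy : x ≠ y) (hadj : ¬ H.Adj x y) :
    ∃ v ∈ R, Touch H {x} (comp H R v) ∧ Touch H {y} (comp H R v) := by
  set M : Set V := U \ {u, z} with hM
  have hxM : x ∈ M \ {y} := ⟨⟨hx, by rintro (h | h) <;> contradiction⟩, hxy⟩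
  have hyM : y ∈ M := ⟨hy, by rintro (h | h) <;> contradiction⟩
  have hA := comp_subset (H := H) hxM
  have hRM : R ⊆ M \ {y} := fun v hv => by
    obtain ⟨h1, h2, h3, h4, h5⟩ := (hR v).1 hv
    exact ⟨⟨h1, by rintro (h | h) <;> contradiction⟩, h4⟩
  have hMR : ∀ v ∈ M \ {y}, v ≠ x → v ∈ R := fun v hv hvx =>
    (hR v).2 ⟨hv.1.1, fun h => hv.1.2 (Or.inl h), hvx, hv.2, fun h => hv.1.2 (Or.inr h)⟩
  obtain ⟨a, ha, b, hb, hbA, hab⟩ := hz.touch (fun v hv => (hA hv).1) ⟨x, mem_comp_self⟩ hyM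
    (fun h => (hA h).2 rfl)
  have hby : b = y := by
    by_contra h
    exact hbA (comp_closed a ha b ⟨hb, h⟩ hab)
  subst hby
  have hax : a ≠ x := by rintro rfl; exact hadj hab
  have haR : a ∈ R := hMR a (hA ha) hax
  refine ⟨a, haR, ?_, ⟨_, rfl, a, mem_comp_self, hab.symm⟩⟩
  have hSA : comp H R a ⊆ comp H (M \ {b}) x :=
    comp_subset_of_closed (fun s hs t ht hst => comp_closed s hs t (hRM ht) hst) ha
  obtain ⟨s, hs, t, ht, htS, hst⟩ := (comp_conn hxM).2.touch hSA ⟨a, mem_comp_self⟩ mem_comp_self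
    (fun h => ((hR x).1 (comp_subset haR h)).2.2.1 rfl)
  have : t = x := by
    by_contra h
    exact htS (comp_closed s hs t (hMR t (hA ht) h) hst)
  subst this
  exact ⟨_, rfl, s, hs, hst.symm⟩

/-- A boundary vertex has at most two boundary neighbours. -/
lemma Core.boundary_degree (C : Core H Z U)
    (tf : ∀ a b c, H.Adj a b → H.Adj b c → H.Adj a c → False) {u a b c : V}
    (hu : u ∈ U) (ha : a ∈ U) (hb : b ∈ U) (hc : c ∈ U)
    (huO : u ∈ Nb H Z) (haO : a ∈ Nb H Z) (hbO : b ∈ Nb H Z) (hcO : c ∈ Nb H Z)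
    (hua : H.Adj u a) (hub : H.Adj u b) (huc : H.Adj u c)
    (hab : a ≠ b) (hac : a ≠ c) (hbc : b ≠ c) : False := by
  set R : Set V := U \ {u, a, b, c} with hR
  have hR' : ∀ v, v ∈ R ↔ v ∈ U ∧ v ≠ u ∧ v ≠ a ∧ v ≠ b ∧ v ≠ c := by
    intro v; simp [hR]
  obtain ⟨x, hx, hxa, hxb⟩ := exists_link (R := R) (C.nosep u hu c hc huO hcO huc) hR'
    ha hb hua.ne' hub.ne' hac hbc hab (fun h => tf u a b hua h hub)
  obtain ⟨y, hy, hyb, hyc⟩ := exists_link (R := R) (C.nosep u hu a ha huO haO hua)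
    (x := b) (y := c) (fun v => by rw [hR']; tauto) hb hc hub.ne' huc.ne' hab.symm hac.symm hbc
    (fun h => tf u b c hub h huc)
  obtain ⟨z, hz, hzc, hza⟩ := exists_link (R := R) (C.nosep u hu b hb huO hbO hub)
    (x := c) (y := a) (fun v => by rw [hR']; tauto) hc ha huc.ne' hua.ne' hbc.symm hab hac.symm
    (fun h => tf u a c hua h.symm huc)
  have hZ : ∀ {A : Set V}, A ⊆ U → Disjoint Z A := fun h => C.disj.mono_right h
  have sU : ∀ {v}, v ∈ U → {v} ⊆ U := fun h => Set.singleton_subset_iff.2 h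
  have tZ : ∀ {v}, v ∈ Nb H Z → Touch H Z {v} := fun ⟨z, hz, hzv⟩ => ⟨z, hz, _, rfl, hzv⟩
  have tS : ∀ {v w}, H.Adj v w → Touch H {v} {w} := fun h => ⟨_, rfl, _, rfl, h⟩
  have dS : ∀ {v w : V}, v ≠ w → Disjoint ({v} : Set V) {w} := fun h => Set.disjoint_singleton.2 h
  have cR : ∀ {v}, v ∈ R → comp H R v ⊆ R := fun h => comp_subset h
  have RU : R ⊆ U := Set.sdiff_subset
  have dR : ∀ {v w}, v ∈ R → w ∉ R → Disjoint {w} (comp H R v) := fun h h' =>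
    Set.disjoint_singleton_left.2 fun h'' => h' (cR h h'')
  have uR : u ∉ R := by simp [hR]
  have aR : a ∉ R := by simp [hR]
  have bR : b ∉ R := by simp [hR]
  have cR' : c ∉ R := by simp [hR]
  have tripod : ∀ v ∈ R, Touch H {a} (comp H R v) → Touch H {b} (comp H R v) →
      Touch H {c} (comp H R v) → False := by
    intro v hv h1 h2 h3
    exact C.k33.elim C.connZ (conn_singleton u) (comp_conn hv) (conn_singleton a)
      (conn_singleton b) (conn_singleton c) (hZ (sU hu)) (hZ ((cR hv).trans RU)) (dR hv uR)
      (dS hab) (dS hac) (dS hbc) (hZ (sU ha)) (hZ (sU hb)) (hZ (sU hc)) (dS hua.ne) (dS hub.ne)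
      (dS huc.ne) (dR hv aR).symm (dR hv bR).symm (dR hv cR').symm (tZ haO) (tZ hbO) (tZ hcO)
      (tS hua) (tS hub) (tS huc) h1.symm h2.symm h3.symm
  rcases comp_disjoint_or_eq (H := H) hx hy with h | hxy
  · exact tripod x hx hxa hxb (h ▸ hyc)
  rcases comp_disjoint_or_eq (H := H) hy hz with h | hyz
  · exact tripod y hy (h ▸ hza) hyb hyc
  rcases comp_disjoint_or_eq (H := H) hx hz with h | hxz
  · exact tripod x hx hxa hxb (h ▸ hzc)
  have dd : ∀ {v w : V} {A B : Set V}, v ≠ w → Disjoint {v} B → Disjoint {w} A → Disjoint A B →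
      Disjoint ({v} ∪ A) ({w} ∪ B) := by
    intro v w A B h1 h2 h3 h4
    rw [Set.disjoint_union_left, Set.disjoint_union_right, Set.disjoint_union_right]
    exact ⟨⟨dS h1, h2⟩, h3.symm, h4⟩
  have l : ∀ {v : V} {A : Set V}, {v} ⊆ {v} ∪ A := by
    intro v A; exact Set.subset_union_left
  have r : ∀ {v : V} {A : Set V}, A ⊆ {v} ∪ A := by
    intro v A; exact Set.subset_union_right
  refine C.k5.elim C.connZ (conn_singleton u) ((conn_singleton a).union (comp_conn hx) hxa)
    ((conn_singleton b).union (comp_conn hy) hyb) ((conn_singleton c).union (comp_conn hz) hzc)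
    (hZ (sU hu)) (hZ (Set.union_subset (sU ha) ((cR hx).trans RU)))
    (hZ (Set.union_subset (sU hb) ((cR hy).trans RU)))
    (hZ (Set.union_subset (sU hc) ((cR hz).trans RU)))
    (Set.disjoint_union_right.2 ⟨dS hua.ne, dR hx uR⟩)
    (Set.disjoint_union_right.2 ⟨dS hub.ne, dR hy uR⟩)
    (Set.disjoint_union_right.2 ⟨dS huc.ne, dR hz uR⟩)
    (dd hab (dR hy aR) (dR hx bR) hxy) (dd hac (dR hz aR) (dR hx cR') hxz)
    (dd hbc (dR hz bR) (dR hy cR') hyz)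
    (tZ huO) ((tZ haO).mono subset_rfl l) ((tZ hbO).mono subset_rfl l)
    ((tZ hcO).mono subset_rfl l) ((tS hua).mono subset_rfl l) ((tS hub).mono subset_rfl l)
    ((tS huc).mono subset_rfl l) (hxb.symm.mono r l) (hza.mono l r) (hyc.symm.mono r l)

end PlanarChoice

namespace PlanarChoice

variable {V : Type} {H : SimpleGraph V} {D Z U : Set V} {y : ℕ → V} {i j : ℕ} {w p q : V}
  {L : V → Finset ℕ}

lemma exists_vertex_function {a b : ℕ} (c : ℕ → ℕ)
    (inj : ∀ k l, a ≤ k → k ≤ b → a ≤ l → l ≤ b → y k = y l → k = l) :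
    ∃ ψ : V → ℕ, ∀ k, a ≤ k → k ≤ b → ψ (y k) = c k := by
  classical
  refine ⟨fun v => if h : ∃ k, a ≤ k ∧ k ≤ b ∧ y k = v then c h.choose else 0, fun k h1 h2 => ?_⟩
  have h : ∃ l, a ≤ l ∧ l ≤ b ∧ y l = y k := ⟨k, h1, h2, rfl⟩
  simp only [h, dif_pos]
  congr 1
  exact inj _ _ h.choose_spec.1 h.choose_spec.2.1 h1 h2 h.choose_spec.2.2

/-- The pocket cut off by `y i`, `w`, `y j`. -/
def pocketSet (H : SimpleGraph V) (U : Set V) (y : ℕ → V) (i j : ℕ) (w : V) : Set V :=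
  comp H (U \ {y i, w, y j}) (y (i + 1))

lemma Pocket.path_subset (P : Pocket H Z U y i j w) {k : ℕ} (h1 : i < k) (h2 : k < j) :
    y k ∈ U \ {y i, w, y j} := by
  refine ⟨P.mem k (by omega) (by omega), ?_⟩
  rintro (h | h | h)
  · have := P.inj _ _ (by omega) (by omega) (by omega) (by omega) h; omega
  · exact P.ne k (by omega) (by omega) h
  · have := P.inj _ _ (by omega) (by omega) (by omega) (by omega) h; omega

lemma Pocket.path_mem (P : Pocket H Z U y i j w) {k : ℕ} (h1 : i < k) (h2 : k < j) :
    y k ∈ pocketSet H U y i j w := by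
  have hB : Conn H (y '' Set.Icc (i + 1) (j - 1)) :=
    conn_image_Icc (by omega) fun k h1 h2 => P.adj k (by omega) (by omega)
  refine hB.subset_comp (S := U \ {y i, w, y j}) ?_ ⟨i + 1, ⟨le_rfl, by omega⟩, rfl⟩
    ⟨k, ⟨h1, by omega⟩, rfl⟩
  rintro v ⟨l, hl, rfl⟩
  have h1 := hl.1
  have h2 := hl.2
  exact P.path_subset (by omega) (by omega)

lemma Pocket.subset (P : Pocket H Z U y i j w) :
    pocketSet H U y i j w ⊆ U \ {y i, w, y j} :=
  comp_subset (P.path_subset (by omega) (by have := P.le; omega))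

lemma Pocket.outside [Finite V] (P : Pocket H Z U y i j w) (C : Core H Z U)
    (hT : Tlt H D U.ncard) (hI : Inst H D Z U p q L)
    (hP : ∀ k, i < k → k < j → y k ≠ p ∧ y k ≠ q) : Col H (U \ pocketSet H U y i j w) L := by
  have hij := P.le
  have hpK : ∀ r, r = p ∨ r = q → r ∉ pocketSet H U y i j w := by
    intro r hr hrK
    obtain ⟨k, h1, h2, rfl⟩ := P.boundary C hrK (by rcases hr with rfl | rfl; exacts [hI.pO, hI.qO])
    rcases hr with h | h
    · exact (hP k h1 h2).1 h
    · exact (hP k h1 h2).2 h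
  refine hT Z _ p q L ?_ ⟨hI.connZ, hI.disj.mono_right Set.sdiff_subset, ⟨hI.hp, hpK p (Or.inl rfl)⟩,
    ⟨hI.hq, hpK q (Or.inr rfl)⟩, hI.pO, hI.qO, hI.pq, hI.pne, hI.qne, fun v hv => hI.big v hv.1⟩
  refine Set.ncard_lt_ncard ⟨Set.sdiff_subset, fun h => ?_⟩
  exact (h (P.mem (i + 1) (by omega) (by omega))).2 (P.path_mem (by omega) (by omega))

lemma Pocket.patch [Finite V] (P : Pocket H Z U y i j w) (C : Core H Z U)
    (tf : ∀ a b c, H.Adj a b → H.Adj b c → H.Adj a c → False)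
    (hT : Tlt H D U.ncard) (hI : Inst H D Z U p q L)
    (hP : ∀ k, i < k → k < j → y k ≠ p ∧ y k ≠ q)
    (hnb : ∀ k, i < k → k < j → ∀ o ∈ U, o ∈ Nb H Z → H.Adj (y k) o →
      o = y (k - 1) ∨ o = y (k + 1))
    {φ : V → ℕ} (hφL : ∀ v ∈ U \ pocketSet H U y i j w, φ v ∈ L v)
    (hφ : ∀ u ∈ U \ pocketSet H U y i j w, ∀ v ∈ U \ pocketSet H U y i j w,
      H.Adj u v → φ u ≠ φ v)
    {a : ℕ} (haj : a < j) (c : ℕ → ℕ) (hcj : c j = φ (y j))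
    (hcL : ∀ k, a ≤ k → k < j → c k ∈ L (y k)) (hcc : ∀ k, a ≤ k → k < j → c k ≠ c (k + 1))
    (hin : ∀ v ∈ U, v ∉ Nb H Z → ∀ k l, a ≤ k → k < l → l ≤ j →
      H.Adj v (y k) → H.Adj v (y l) → False)
    (x : ℕ)
    (hcase : a = i + 1 ∧ c a ≠ φ (y i) ∨ a = i + 2 ∧ y (i + 1) ∈ D ∧ x ∈ L (y (i + 1)) ∧
      x ≠ φ (y i) ∧ c a ≠ x) : Col H U L := by
  classical
  have hij := P.le
  have hia : i < a := by omega
  set K := pocketSet H U y i j w with hK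
  have hKs : K ⊆ U \ {y i, w, y j} := P.subset
  have hyK : ∀ {k}, i < k → k < j → y k ∈ K := fun h1 h2 => P.path_mem h1 h2
  have hKi : y i ∉ K := fun h => (hKs h).2 (Or.inl rfl)
  have hKw : w ∉ K := fun h => (hKs h).2 (Or.inr (Or.inl rfl))
  have hKj : y j ∉ K := fun h => (hKs h).2 (Or.inr (Or.inr rfl))
  have hij' : y i ≠ y j := fun h => by
    have := P.inj i j le_rfl (by omega) (by omega) le_rfl h; omega
  have hiw := P.ne i le_rfl (by omega)
  have hjw := P.ne j (by omega) le_rfl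
  have hiU := P.mem i le_rfl (by omega)
  have hjU := P.mem j (by omega) le_rfl
  have hadj : H.Adj (y i) w := P.wi.symm
  have hφiw : φ (y i) ≠ φ w := hφ _ ⟨hiU, hKi⟩ _ ⟨P.wU, hKw⟩ hadj
  have hφwj : φ w ≠ φ (y j) := hφ _ ⟨P.wU, hKw⟩ _ ⟨hjU, hKj⟩ P.wj
  have hbd : ∀ v ∈ K, v ∈ Nb H Z → ∃ k, i < k ∧ k < j ∧ v = y k := fun v hv h => P.boundary C hv h
  have hpK : ∀ v ∈ K, v ≠ p ∧ v ≠ q := by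
    intro v hv
    refine ⟨?_, ?_⟩
    · rintro rfl
      obtain ⟨k, h1, h2, h⟩ := hbd _ hv hI.pO
      exact (hP k h1 h2).1 h.symm
    · rintro rfl
      obtain ⟨k, h1, h2, h⟩ := hbd _ hv hI.qO
      exact (hP k h1 h2).2 h.symm
  set U' : Set V := K ∪ {y i, w, y j} with hU'
  set Q : Set V := y '' Set.Icc a j with hQ
  have hU'U : U' ⊆ U := by
    rintro v (h | rfl | rfl | rfl)
    exacts [(hKs h).1, hiU, P.wU, hjU]
  have hQj : y j ∈ Q := ⟨j, ⟨by omega, le_rfl⟩, rfl⟩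
  have hiQ : y i ∉ Q := by
    rintro ⟨k, hk, h⟩
    have h1 := hk.1
    have := P.inj k i (by omega) hk.2 le_rfl (by omega) h
    omega
  have hwQ : w ∉ Q := by
    rintro ⟨k, hk, h⟩
    exact P.ne k (by have := hk.1; omega) hk.2 h
  have hKU : ∀ {v}, v ∈ K → v ∈ U := fun h => (hKs h).1
  have hU'K : ∀ v ∈ U' \ Q, v ∈ K ∨ v = y i ∨ v = w := by
    rintro v ⟨h | rfl | rfl | rfl, hvQ⟩
    · exact Or.inl h
    · exact Or.inr (Or.inl rfl)
    · exact Or.inr (Or.inr rfl)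
    · exact absurd hQj hvQ
  let Lh : V → Finset ℕ := fun v => if v = y i then {φ (y i)} else if v = w then {φ w} else
    if a = i + 2 ∧ v = y (i + 1) then {φ (y i), x} else L v
  have hLi : Lh (y i) = {φ (y i)} := by simp [Lh]
  have hLw : Lh w = {φ w} := by simp [Lh, hiw.symm]
  have hLK : ∀ v ∈ K, ¬ (a = i + 2 ∧ v = y (i + 1)) → Lh v = L v := by
    intro v hv h
    have h1 : v ≠ y i := fun h => hKi (h ▸ hv)
    have h2 : v ≠ w := fun h => hKw (h ▸ hv)
    simp [Lh, h1, h2, h]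
  have hLx : a = i + 2 → Lh (y (i + 1)) = {φ (y i), x} := by
    intro h
    have hv : y (i + 1) ∈ K := hyK (by omega) (by omega)
    have h1 : y (i + 1) ≠ y i := fun h => hKi (h ▸ hv)
    have h2 : y (i + 1) ≠ w := fun h => hKw (h ▸ hv)
    simp [Lh, h1, h2, h]
  obtain ⟨ψ, hψ⟩ := exists_vertex_function (y := y) (a := i) (b := j) c P.inj
  have nbr : ∀ k l, i < k → k < j → i ≤ l → l ≤ j → H.Adj (y k) (y l) → l + 1 = k ∨ l = k + 1 := by
    intro k l h1 h2 h3 h4 h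
    rcases hnb k h1 h2 _ (P.mem l h3 h4) (P.nb l h3 h4) h with h | h
    · have := P.inj _ _ h3 h4 (by omega) (by omega) h; omega
    · have := P.inj _ _ h3 h4 (by omega) (by omega) h; omega
  have hlt : (U' \ Q).ncard < U.ncard :=
    Set.ncard_lt_ncard ⟨fun v hv => hU'U hv.1, fun h => (h hjU).2 hQj⟩
  obtain ⟨χ, hχ1, hχ2, hχ3⟩ := removal (Z := Z) (D := D) (p := y i) (q := w) (L := Lh) hT hlt
    hI.connZ (hI.disj.mono_right hU'U)
    (by rintro v ⟨k, hk, rfl⟩; exact P.nb k (by have := hk.1; omega) hk.2)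
    ⟨Or.inr (Or.inl rfl), hiQ⟩ ⟨Or.inr (Or.inr (Or.inl rfl)), hwQ⟩
    (Nb_mono Set.subset_union_left (P.nb i le_rfl (by omega)))
    ⟨y j, Or.inr hQj, P.wj.symm⟩
    (Or.inr ⟨hadj, by rw [hLi, hLw]; simpa using hφiw⟩) (by rw [hLi]; simp) (by rw [hLw]; simp)
    (by
      intro v hv hvi hvw
      have hvK : v ∈ K := by
        rcases hU'K v hv with h | h | h
        exacts [h, absurd h hvi, absurd h hvw]
      obtain ⟨h1, h2⟩ := hpK v hvK
      have hw4 := hI.big v (hKU hvK) h1 h2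
      by_cases hx : a = i + 2 ∧ v = y (i + 1)
      · obtain ⟨h3, rfl⟩ := hx
        rcases hcase with h | ⟨_, h4, h5, h6, _⟩
        · omega
        have : y (i + 1) ∈ Nb H Z := P.nb _ (by omega) (by omega)
        simp only [Nb, Set.mem_ofPred_eq] at this
        rw [weight, if_pos this, if_pos h4, hLx h3, Finset.card_pair h6.symm]
      · simpa only [weight, hLK v hvK hx] using hw4)
    ψ
    (by
      rintro u ⟨k, hk, rfl⟩ v ⟨l, hl, rfl⟩ huv
      have hk1 := hk.1
      have hk2 := hk.2
      have hl1 := hl.1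
      have hl2 := hl.2
      rw [hψ k (by omega) hk2, hψ l (by omega) hl2]
      by_cases hkj : k = j
      · by_cases hlj : l = j
        · subst hkj; subst hlj; exact (H.irrefl huv).elim
        · rcases nbr l k (by omega) (by omega) (by omega) hk2 huv.symm with h | h
          · omega
          · subst h; exact (hcc l (by omega) (by omega)).symm
      · rcases nbr k l (by omega) (by omega) (by omega) hl2 huv with h | h
        · subst h; exact (hcc l (by omega) (by omega)).symm
        · subst h; exact hcc k (by omega) (by omega))
    (by
      rintro v hv hvO u ⟨l, hl, rfl⟩ hvu hmem
      have hl1 := hl.1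
      have hl2 := hl.2
      rw [hψ l (by omega) hl2] at hmem ⊢
      rcases hU'K v hv with hvK | rfl | rfl
      · have hvZ : v ∈ Nb H Z := by
          rcases hvO with h | rfl | rfl
          exacts [h, absurd hvK hKi, absurd hvK hKw]
        obtain ⟨k, hk1, hk2, rfl⟩ := hbd v hvK hvZ
        have hka : k < a := by
          by_contra h
          exact hv.2 ⟨k, ⟨by omega, by omega⟩, rfl⟩
        have hlk : l = k + 1 := by
          rcases nbr k l hk1 hk2 (by omega) hl2 hvu with h | h <;> omega
        rcases hcase with ⟨h1, h2⟩ | ⟨h1, h2, h3, h4, h5⟩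
        · omega
        obtain rfl : k = i + 1 := by omega
        obtain rfl : l = a := by omega
        rw [hLx h1, Finset.mem_insert, Finset.mem_singleton] at hmem
        rcases hmem with h | h
        · exact ⟨y i, Or.inl rfl, (P.adj i le_rfl (by omega)).symm, by rw [hLi, h]⟩
        · exact absurd h h5
      · by_cases hlj : l = j
        · subst hlj; exact (tf w (y i) (y l) P.wi hvu P.wj).elim
        · have hli : l = i + 1 := by
            rcases nbr l i (by omega) (by omega) le_rfl (by omega) hvu.symm with h | h <;> omega
          subst hli
          rw [hLi, Finset.mem_singleton] at hmem
          rcases hcase with ⟨h1, h2⟩ | ⟨h1, _⟩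
          · subst h1; exact absurd hmem h2
          · omega
      · rw [hLw, Finset.mem_singleton] at hmem
        exact ⟨y i, Or.inl rfl, P.wi, by
          by_cases hlj : l = j
          · subst hlj; rw [hcj] at hmem; exact absurd hmem.symm hφwj
          · exact (hin _ P.wU P.wO l j hl1 (by omega) le_rfl hvu P.wj).elim⟩)
    (by
      rintro v hv hvO - - u ⟨k, hk, rfl⟩ u' ⟨l, hl, rfl⟩ h1 h2
      have hkl : k = l := by
        rcases Nat.lt_trichotomy k l with h | h | h
        · exact (hin v (hU'U hv.1) hvO k l hk.1 h hl.2 h1 h2).elim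
        · exact h
        · exact (hin v (hU'U hv.1) hvO l k hl.1 h hk.2 h2 h1).elim
      rw [hkl])
  refine Col.glue (K := K) (S := {y i, w, y j}) φ hφL hφ χ (fun v hv => ?_) hχ3 ?_ ?_
  · by_cases hvQ : v ∈ Q
    · rw [hχ2 v hvQ]
      obtain ⟨k, hk, rfl⟩ := hvQ
      have hk1 := hk.1
      have hkj : k ≠ j := by rintro rfl; exact hKj hv
      rw [hψ k (by omega) hk.2]
      exact hcL k hk1 (lt_of_le_of_ne hk.2 hkj)
    · have h1 := hχ1 v ⟨Or.inl hv, hvQ⟩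
      by_cases hx : a = i + 2 ∧ v = y (i + 1)
      · obtain ⟨h2, rfl⟩ := hx
        rcases hcase with h | ⟨_, h4, h5, h6, _⟩
        · omega
        rw [hLx h2, Finset.mem_insert, Finset.mem_singleton] at h1
        rcases h1 with h | h
        · have h7 := hχ1 (y i) ⟨Or.inr (Or.inl rfl), hiQ⟩
          rw [hLi, Finset.mem_singleton] at h7
          exact absurd (h7.trans h.symm) (hχ3 _ (Or.inr (Or.inl rfl)) _ (Or.inl hv)
            (P.adj i le_rfl (by omega)))
        · rw [h]; exact h5
      · rwa [hLK v hv hx] at h1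
  · rintro v (rfl | rfl | rfl)
    · have h7 := hχ1 (y i) ⟨Or.inr (Or.inl rfl), hiQ⟩
      rwa [hLi, Finset.mem_singleton] at h7
    · have h7 := hχ1 v ⟨Or.inr (Or.inr (Or.inl rfl)), hwQ⟩
      rwa [hLw, Finset.mem_singleton] at h7
    · rw [hχ2 _ hQj, hψ j (by omega) le_rfl, hcj]
  · intro u hu v hv huv
    by_contra h
    exact hv.2 (comp_closed u hu v ⟨hv.1, h⟩ huv)

end PlanarChoice

namespace PlanarChoice

variable {V : Type} {H : SimpleGraph V} {D Z U : Set V} {y : ℕ → V} {i j : ℕ} {w p q : V}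
  {L : V → Finset ℕ}

lemma Pocket.path_neighbours (P : Pocket H Z U y i j w) (C : Core H Z U)
    (tf : ∀ a b c, H.Adj a b → H.Adj b c → H.Adj a c → False) :
    ∀ k, i < k → k < j → ∀ o ∈ U, o ∈ Nb H Z → H.Adj (y k) o → o = y (k - 1) ∨ o = y (k + 1) := by
  intro k h1 h2 o hoU hoO hko
  by_contra! h
  have h3 := P.adj (k - 1) (by omega) (by omega)
  rw [Nat.sub_add_cancel (by omega)] at h3
  refine C.boundary_degree tf (P.mem k (by omega) (by omega)) (P.mem (k - 1) (by omega) (by omega))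
    (P.mem (k + 1) (by omega) (by omega)) hoU (P.nb k (by omega) (by omega))
    (P.nb (k - 1) (by omega) (by omega)) (P.nb (k + 1) (by omega) (by omega)) hoO h3.symm
    (P.adj k (by omega) (by omega)) hko (fun h => ?_) h.1.symm h.2.symm
  have := P.inj _ _ (by omega) (by omega) (by omega) (by omega) h
  omega

lemma weight_list_three {v : V} (h : 4 ≤ weight H D Z L v) (hD : v ∉ D) : 3 ≤ (L v).card := by
  unfold weight at h
  rw [if_neg hD] at h
  split_ifs at h <;> omega

lemma Pocket.col_of_notMem [Finite V] (C : Core H Z U)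
    (tf : ∀ a b c, H.Adj a b → H.Adj b c → H.Adj a c → False)
    (hT : Tlt H D U.ncard) (hI : Inst H D Z U p q L) (P : Pocket H Z U y i j w)
    (hP : ∀ k, i < k → k < j → y k ≠ p ∧ y k ≠ q) (hD : ∀ k, i < k → k < j → y k ∉ D) :
    Col H U L := by
  induction hm : j - i using Nat.strong_induction_on generalizing i j w with
  | _ m ih =>
    by_cases hsm : ∃ i' j' w', i ≤ i' ∧ j' ≤ j ∧ j' - i' < m ∧ Pocket H Z U y i' j' w'
    · obtain ⟨i', j', w', h1, h2, h3, P'⟩ := hsm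
      exact ih _ h3 P' (fun k h h' => hP k (by omega) (by omega))
        (fun k h h' => hD k (by omega) (by omega)) rfl
    push Not at hsm
    have hij := P.le
    obtain ⟨φ, hφL, hφ⟩ := P.outside C hT hI hP
    have hbig : ∀ k, i < k → k < j → 3 ≤ (L (y k)).card := fun k h1 h2 =>
      weight_list_three (hI.big _ (P.mem k (by omega) (by omega)) (hP k h1 h2).1 (hP k h1 h2).2)
        (hD k h1 h2)
    obtain ⟨c, h1, h2, h3, h4⟩ := greedy (fun k => L (y k)) (fun _ => φ (y i))
      {φ (y i), φ (y j)} Finset.card_le_two (i + 1) (j - 1) (by omega)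
      (fun k h h' => hbig k (by omega) (by omega))
    simp only [Finset.mem_insert, Finset.mem_singleton, not_or] at h3
    refine P.patch C tf hT hI hP (P.path_neighbours C tf) hφL hφ (a := i + 1) (by omega)
      (fun k => if k = j then φ (y j) else c k) (by simp) (fun k hk hk' => ?_)
      (fun k hk hk' => ?_) (fun v hv hvO k l hk hkl hl hvk hvl => ?_) 0 (Or.inl ⟨rfl, ?_⟩)
    · rw [if_neg (by omega)]; exact h1 k hk (by omega)
    · rw [if_neg (by omega)]
      split_ifs with h
      · obtain rfl : k = j - 1 := by omega
        exact h3.2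
      · exact h2 k hk (by omega)
    · by_cases h : l = k + 1
      · subst h
        exact tf v _ _ hvk (P.adj k (by omega) (by omega)) hvl
      · exact hsm k l v (by omega) hl (by omega) ⟨by omega, fun t _ _ => P.mem t (by omega) (by omega),
          fun t _ _ => P.nb t (by omega) (by omega),
          fun s t _ _ _ _ => P.inj s t (by omega) (by omega) (by omega) (by omega),
          fun t _ _ => P.adj t (by omega) (by omega), hv, hvO, hvk, hvl⟩
    · rw [if_neg (by omega)]
      by_cases h : i + 1 = j - 1
      · rw [h]; exact h3.1
      · exact h4 _ le_rfl (by omega)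

lemma Pocket.col_of_three [Finite V] (C : Core H Z U)
    (tf : ∀ a b c, H.Adj a b → H.Adj b c → H.Adj a c → False)
    (hT : Tlt H D U.ncard) (hI : Inst H D Z U p q L) (P : Pocket H Z U y i (i + 3) w)
    (hP : ∀ k, i < k → k < i + 3 → y k ≠ p ∧ y k ≠ q) (hD : y (i + 1) ∈ D)
    (hD' : y (i + 2) ∉ D) : Col H U L := by
  obtain ⟨φ, hφL, hφ⟩ := P.outside C hT hI hP
  have hbig : ∀ k, i < k → k < i + 3 → 4 ≤ weight H D Z L (y k) := fun k h1 h2 =>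
    hI.big _ (P.mem k (by omega) (by omega)) (hP k h1 h2).1 (hP k h1 h2).2
  obtain ⟨x, hx, hx'⟩ := exists_mem_notMem_of_card (s := L (y (i + 1))) (t := {φ (y i)})
    (by have := weight_list_pos (hbig (i + 1) (by omega) (by omega)); simp; omega)
  obtain ⟨e, he, he'⟩ := exists_mem_notMem_of_card (s := L (y (i + 2))) (t := {x, φ (y (i + 3))})
    (by have := weight_list_three (hbig (i + 2) (by omega) (by omega)) hD'
        have := Finset.card_le_two (a := x) (b := φ (y (i + 3))); omega)
  simp only [Finset.mem_insert, Finset.mem_singleton, not_or] at hx' he'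
  refine P.patch C tf hT hI hP (P.path_neighbours C tf) hφL hφ (a := i + 2) (by omega)
    (fun k => if k = i + 3 then φ (y (i + 3)) else e) (by simp) (fun k hk hk' => ?_)
    (fun k hk hk' => ?_) (fun v hv hvO k l hk hkl hl hvk hvl => ?_) x
    (Or.inr ⟨rfl, hD, hx, hx', ?_⟩)
  · obtain rfl : k = i + 2 := by omega
    simpa using he
  · obtain rfl : k = i + 2 := by omega
    simpa using he'.2
  · obtain rfl : k = i + 2 := by omega
    obtain rfl : l = i + 3 := by omega
    exact tf v _ _ hvk (P.adj _ (by omega) (by omega)) hvl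
  · simpa using he'.1

end PlanarChoice

namespace PlanarChoice

variable {V : Type} {H : SimpleGraph V} {D Z U : Set V} {y : ℕ → V} {p q z : V} {n : ℕ}
  {L : V → Finset ℕ}

/-- A path `y 0 = p, y 1 = z, …, y n` in the boundary avoiding `q`. -/
structure BPath (H : SimpleGraph V) (Z U : Set V) (p q z : V) (n : ℕ) (y : ℕ → V) : Prop where
  pos : 1 ≤ n
  zero : y 0 = p
  one : y 1 = z
  mem : ∀ k ≤ n, y k ∈ U
  nb : ∀ k ≤ n, y k ∈ Nb H Z
  inj : ∀ k ≤ n, ∀ l ≤ n, y k = y l → k = l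
  adj : ∀ k < n, H.Adj (y k) (y (k + 1))
  ne_q : ∀ k ≤ n, y k ≠ q

lemma exists_maximal_path [Finite V] (hp : p ∈ U) (hpO : p ∈ Nb H Z) (hz : z ∈ U)
    (hzO : z ∈ Nb H Z) (hpz : H.Adj p z) (hpq : p ≠ q) (hzq : z ≠ q) :
    ∃ n y, BPath H Z U p q z n y ∧
      ∀ o ∈ U, o ∈ Nb H Z → H.Adj (y n) o → o ≠ q → ∃ l ≤ n, o = y l := by
  classical
  have hbd : ∀ n y, BPath H Z U p q z n y → n ≤ Nat.card V := by
    intro n y P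
    have hinj : Set.InjOn y (Finset.range (n + 1) : Set ℕ) := by
      intro k hk l hl h
      simp only [Finset.coe_range, Set.mem_Iio] at hk hl
      exact P.inj k (by omega) l (by omega) h
    have h := hinj.ncard_image
    rw [Set.ncard_coe_finset, Finset.card_range] at h
    have := Set.ncard_le_card (y '' (Finset.range (n + 1) : Set ℕ))
    omega
  have h1 : BPath H Z U p q z 1 (fun k => if k = 0 then p else z) := by
    have e : ∀ k ≤ 1, k = 0 ∨ k = 1 := by intro k hk; omega
    refine ⟨le_rfl, rfl, rfl, ?_, ?_, ?_, ?_, ?_⟩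
    · intro k hk; rcases e k hk with rfl | rfl <;> simpa
    · intro k hk; rcases e k hk with rfl | rfl <;> simpa
    · intro k hk l hl
      rcases e k hk with rfl | rfl <;> rcases e l hl with rfl | rfl <;> simp [hpz.ne, hpz.ne']
    · intro k hk; obtain rfl : k = 0 := by omega
      simpa
    · intro k hk; rcases e k hk with rfl | rfl <;> simpa
  set N := Nat.findGreatest (fun n => ∃ y, BPath H Z U p q z n y) (Nat.card V) with hN
  obtain ⟨y, P⟩ : ∃ y, BPath H Z U p q z N y :=
    Nat.findGreatest_spec (P := fun n => ∃ y, BPath H Z U p q z n y) (hbd _ _ h1) ⟨_, h1⟩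
  refine ⟨N, y, P, fun o hoU hoO ho hoq => ?_⟩
  by_contra! hnot
  have hpos := P.pos
  have hlow : ∀ k ≤ N, Function.update y (N + 1) o k = y k := fun k hk =>
    Function.update_of_ne (by omega) _ _
  have hcases : ∀ k ≤ N + 1, k ≤ N ∨ k = N + 1 := by intro k hk; omega
  have P' : BPath H Z U p q z (N + 1) (Function.update y (N + 1) o) := by
    refine ⟨by omega, ?_, ?_, ?_, ?_, ?_, ?_, ?_⟩
    · rw [hlow 0 (by omega), P.zero]
    · rw [hlow 1 (by omega), P.one]
    · intro k hk
      rcases hcases k hk with h | rfl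
      · rw [hlow k h]; exact P.mem k h
      · rwa [Function.update_self]
    · intro k hk
      rcases hcases k hk with h | rfl
      · rw [hlow k h]; exact P.nb k h
      · rwa [Function.update_self]
    · intro k hk l hl
      rcases hcases k hk with h | rfl <;> rcases hcases l hl with h' | rfl
      · rw [hlow k h, hlow l h']; exact P.inj k h l h'
      · rw [hlow k h, Function.update_self]; exact fun e => absurd e.symm (hnot k h)
      · rw [hlow l h', Function.update_self]; exact fun e => absurd e (hnot l h')
      · exact fun _ => rfl
    · intro k hk
      rcases hcases (k + 1) (by omega) with h | h
      · rw [hlow k (by omega), hlow _ h]; exact P.adj k (by omega)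
      · have e : k = N := by omega
        rw [e, hlow N le_rfl, Function.update_self]; exact ho
    · intro k hk
      rcases hcases k hk with h | rfl
      · rw [hlow k h]; exact P.ne_q k h
      · rwa [Function.update_self]
  have := Nat.le_findGreatest (P := fun n => ∃ y, BPath H Z U p q z n y) (hbd _ _ P') ⟨_, P'⟩
  omega

/-- The boundary neighbours of a vertex of a maximal boundary path. -/
lemma BPath.neighbours (P : BPath H Z U p q z n y) (C : Core H Z U)
    (tf : ∀ a b c, H.Adj a b → H.Adj b c → H.Adj a c → False)
    (hmax : ∀ o ∈ U, o ∈ Nb H Z → H.Adj (y n) o → o ≠ q → ∃ l ≤ n, o = y l)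
    (hq : q ∈ U) (hqO : q ∈ Nb H Z) (hpq : H.Adj p q) {k : ℕ} (hk : 1 ≤ k) (hkn : k ≤ n) {o : V}
    (hoU : o ∈ U) (hoO : o ∈ Nb H Z) (ho : H.Adj (y k) o) :
    o = y (k - 1) ∨ (k < n ∧ o = y (k + 1)) ∨ (k = n ∧ o = q) := by
  have inner : ∀ k, 1 ≤ k → k < n → ∀ o ∈ U, o ∈ Nb H Z → H.Adj (y k) o →
      o = y (k - 1) ∨ o = y (k + 1) := by
    intro k hk hkn o hoU hoO ho
    by_contra! h
    have h3 := P.adj (k - 1) (by omega)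
    rw [Nat.sub_add_cancel (by omega)] at h3
    refine C.boundary_degree tf (P.mem k hkn.le) (P.mem (k - 1) (by omega)) (P.mem (k + 1) hkn) hoU
      (P.nb k hkn.le) (P.nb (k - 1) (by omega)) (P.nb (k + 1) hkn) hoO h3.symm (P.adj k hkn) ho
      (fun h => ?_) h.1.symm h.2.symm
    have := P.inj _ (by omega) _ (by omega) h
    omega
  rcases hkn.lt_or_eq with hlt | rfl
  · rcases inner k hk hlt o hoU hoO ho with h | h
    · exact Or.inl h
    · exact Or.inr (Or.inl ⟨hlt, h⟩)
  by_cases hoq : o = q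
  · exact Or.inr (Or.inr ⟨rfl, hoq⟩)
  obtain ⟨l, hl, rfl⟩ := hmax o hoU hoO ho hoq
  by_cases hl1 : l = k - 1
  · exact Or.inl (by rw [hl1])
  exfalso
  have hlk : l ≠ k := by rintro rfl; exact H.irrefl ho
  rcases Nat.eq_zero_or_pos l with rfl | hlpos
  · have h01 := P.adj 0 (by omega)
    refine C.boundary_degree tf (P.mem 0 (by omega)) (P.mem 1 (by omega)) (P.mem k le_rfl) hq
      (P.nb 0 (by omega)) (P.nb 1 (by omega)) (P.nb k le_rfl) hqO h01 ho.symm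
      (by rw [P.zero]; exact hpq) (fun h => ?_) (P.ne_q _ (by omega)) (P.ne_q _ le_rfl)
    have := P.inj _ (by omega) _ (by omega) h
    omega
  · rcases inner l hlpos (by omega) _ (P.mem k le_rfl) (P.nb k le_rfl) ho.symm with h | h
    · have := P.inj _ (by omega) _ (by omega) h; omega
    · have := P.inj _ (by omega) _ (by omega) h; omega

/-- Colour and remove the stretch `y a, …, y b` of a maximal boundary path. -/
lemma BPath.remove_stretch [Finite V] (P : BPath H Z U p q z n y) (C : Core H Z U)
    (tf : ∀ a b c, H.Adj a b → H.Adj b c → H.Adj a c → False)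
    (hmax : ∀ o ∈ U, o ∈ Nb H Z → H.Adj (y n) o → o ≠ q → ∃ l ≤ n, o = y l)
    (hT : Tlt H D U.ncard) (hI : Inst H D Z U p q L) (hpq : H.Adj p q) {a b : ℕ} (c : ℕ → ℕ)
    (ha : 1 ≤ a) (hab : a ≤ b) (hbn : b ≤ n) (hcL : ∀ k, a ≤ k → k ≤ b → c k ∈ L (y k))
    (hcc : ∀ k, a ≤ k → k < b → c k ≠ c (k + 1)) (hb : b < n → c b ∉ L (y (b + 1)))
    (hbq : b = n → H.Adj (y n) q → c b ∉ L q)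
    (hca : c a ∉ L (y (a - 1)) ∨ a = 2 ∧ L p = {c a})
    (hW : ∀ v ∈ U, v ∉ Nb H Z → ∀ k l, a ≤ k → k < l → l ≤ b → H.Adj v (y k) → H.Adj v (y l) →
      c k = c l) : Col H U L := by
  obtain ⟨ψ, hψ⟩ := exists_vertex_function (y := y) (a := a) (b := b) c
    fun k l _ hk _ hl => P.inj k (hk.trans hbn) l (hl.trans hbn)
  set Q : Set V := y '' Set.Icc a b with hQ
  have haQ : y a ∈ Q := ⟨a, ⟨le_rfl, hab⟩, rfl⟩
  have hnot : ∀ k ≤ n, y k ∉ Q → k < a ∨ b < k := by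
    intro k hk h
    by_contra! h'
    exact h ⟨k, h', rfl⟩
  have nbr : ∀ {k o}, a ≤ k → k ≤ b → o ∈ U → o ∈ Nb H Z → H.Adj (y k) o →
      o = y (k - 1) ∨ (k < n ∧ o = y (k + 1)) ∨ (k = n ∧ o = q) := fun h1 h2 h3 h4 h5 =>
    P.neighbours C tf hmax hI.hq hI.qO hpq (by omega) (by omega) h3 h4 h5
  have hpQ : p ∉ Q := by
    rintro ⟨k, hk, h⟩
    rw [← P.zero] at h
    have := P.inj _ (hk.2.trans hbn) _ (by omega) h
    have := hk.1
    omega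
  have hqQ : q ∉ Q := by
    rintro ⟨k, hk, h⟩
    exact P.ne_q k (hk.2.trans hbn) h
  obtain ⟨φ, h1, h2, h3⟩ := removal (Q := Q) (ψ := ψ) hT
    (Set.ncard_lt_ncard ⟨Set.sdiff_subset, fun h => (h (P.mem a (by omega))).2 haQ⟩)
    hI.connZ hI.disj (by rintro v ⟨k, hk, rfl⟩; exact P.nb k (hk.2.trans hbn))
    ⟨hI.hp, hpQ⟩ ⟨hI.hq, hqQ⟩ (Nb_mono Set.subset_union_left hI.pO)
    (Nb_mono Set.subset_union_left hI.qO) hI.pq hI.pne hI.qne (fun v hv => hI.big v hv.1)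
    (by
      rintro u ⟨k, hk, rfl⟩ v ⟨l, hl, rfl⟩ huv
      have hk1 := hk.1
      have hk2 := hk.2
      have hl1 := hl.1
      have hl2 := hl.2
      rw [hψ k hk1 hk2, hψ l hl1 hl2]
      rcases nbr hk1 hk2 (P.mem l (by omega)) (P.nb l (by omega)) huv with h | ⟨_, h⟩ | ⟨_, h⟩
      · have := P.inj _ (by omega) _ (by omega) h
        obtain rfl : k = l + 1 := by omega
        exact (hcc l hl1 (by omega)).symm
      · have := P.inj _ (by omega) _ (by omega) h
        subst this
        exact hcc k hk1 (by omega)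
      · exact absurd h (P.ne_q l (by omega)))
    (by
      rintro o ⟨hoU, hoQ⟩ ho v ⟨l, hl, rfl⟩ hov hmem
      have hl1 := hl.1
      have hl2 := hl.2
      have hoO : o ∈ Nb H Z := by
        rcases ho with h | rfl | rfl
        exacts [h, hI.pO, hI.qO]
      rw [hψ l hl1 hl2] at hmem ⊢
      rcases nbr hl1 hl2 hoU hoO hov.symm with rfl | ⟨hln, rfl⟩ | ⟨hln, rfl⟩
      · have := hnot _ (by omega) hoQ
        obtain rfl : l = a := by omega
        rcases hca with h | ⟨rfl, h⟩
        · exact absurd hmem h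
        · refine ⟨p, Or.inl rfl, ?_, h⟩
          rw [← P.zero]
          exact (P.adj 0 (by omega)).symm
      · have := hnot _ (by omega) hoQ
        obtain rfl : l = b := by omega
        exact absurd hmem (hb hln)
      · obtain rfl : l = b := by omega
        exact absurd hmem (hbq hln (by rw [← hln]; exact hov.symm)))
    (by
      rintro v ⟨hvU, -⟩ hvO - - u ⟨k, hk, rfl⟩ u' ⟨l, hl, rfl⟩ hvu hvu'
      rw [hψ k hk.1 hk.2, hψ l hl.1 hl.2]
      rcases Nat.lt_trichotomy k l with h | h | h
      · exact hW v hvU hvO k l hk.1 h hl.2 hvu hvu'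
      · rw [h]
      · exact (hW v hvU hvO l k hl.1 h hk.2 hvu' hvu).symm)
  refine ⟨φ, fun v hv => ?_, h3⟩
  by_cases hvQ : v ∈ Q
  · rw [h2 v hvQ]
    obtain ⟨k, hk, rfl⟩ := hvQ
    rw [hψ k hk.1 hk.2]
    exact hcL k hk.1 hk.2
  · exact h1 v ⟨hv, hvQ⟩

end PlanarChoice

namespace PlanarChoice

variable {V : Type} {H : SimpleGraph V} {D Z U : Set V} {y : ℕ → V} {p q z : V} {n : ℕ}
  {L : V → Finset ℕ}

/-- The colouring step along a maximal boundary path, starting from its vertex `y s ∉ D`. -/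
lemma BPath.col_from [Finite V] (P : BPath H Z U p q z n y) (C : Core H Z U)
    (tf : ∀ a b c, H.Adj a b → H.Adj b c → H.Adj a c → False)
    (hDind : ∀ u ∈ D, ∀ v ∈ D, ¬ H.Adj u v)
    (hmax : ∀ o ∈ U, o ∈ Nb H Z → H.Adj (y n) o → o ≠ q → ∃ l ≤ n, o = y l)
    (hT : Tlt H D U.ncard) (hI : Inst H D Z U p q L) (hpq : H.Adj p q)
    (hex : ∀ v ∈ U, v ≠ p → v ≠ q → weight H D Z L v = 4) (hLq : (L q).card ≤ 1)
    {s : ℕ} (hs : 1 ≤ s) (hsn : s ≤ n) (hsD : y s ∉ D) (c0 : ℕ)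
    (hc0 : ∀ c, c ≠ c0 → c ∉ L (y (s - 1)) ∨ s = 2 ∧ L p = {c}) : Col H U L := by
  classical
  by_contra hcol
  have hne : ∀ k, 1 ≤ k → k ≤ n → y k ≠ p ∧ y k ≠ q := by
    refine fun k h1 h2 => ⟨fun h => ?_, P.ne_q k h2⟩
    rw [← P.zero] at h
    have := P.inj _ h2 _ (by omega) h
    omega
  have hpk : ∀ {v i j}, v ∈ U → v ∉ Nb H Z → i + 2 ≤ j → j ≤ n → H.Adj v (y i) → H.Adj v (y j) →
      Pocket H Z U y i j v := fun {v i j} hv hvO hij hj h1 h2 =>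
    ⟨hij, fun k _ _ => P.mem k (by omega), fun k _ _ => P.nb k (by omega),
      fun k l _ _ _ _ => P.inj k (by omega) l (by omega), fun k _ _ => P.adj k (by omega), hv, hvO,
      h1, h2⟩
  have hwt : ∀ k, 1 ≤ k → k ≤ n → (L (y k)).card + 1 + (if y k ∈ D then 1 else 0) = 4 := by
    intro k h1 h2
    have h := hex _ (P.mem k h2) (hne k h1 h2).1 (hne k h1 h2).2
    have h3 := P.nb k h2
    simp only [Nb, Set.mem_ofPred_eq] at h3
    rwa [weight, if_pos h3] at h
  let E : ℕ → Finset ℕ := fun k => if k ≤ n then L (y k) else if H.Adj (y n) q then L q else ∅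
  have hE : ∀ k ≤ n, E k = L (y k) := fun k hk => if_pos hk
  have hfar : ∀ i j, s ≤ i → i < j → j ≤ n → (∃ v ∈ U, v ∉ Nb H Z ∧ H.Adj v (y i) ∧ H.Adj v (y j)) →
      i + 2 ≤ j := by
    rintro i j hi hij hj ⟨v, -, -, h1, h2⟩
    by_contra h
    obtain rfl : j = i + 1 := by omega
    exact tf v _ _ h1 (P.adj i (by omega)) h2
  obtain ⟨a, b, c, hsa, hab, hbn, hcL, hcc, hcb, hca, hcW⟩ := exists_piece n s c0 E
    (fun k => y k ∈ D) (fun i j => ∃ v ∈ U, v ∉ Nb H Z ∧ H.Adj v (y i) ∧ H.Adj v (y j)) hsn hsD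
    (fun k h1 h2 h3 => by
      have := hwt k (by omega) h2
      rw [if_neg h3] at this; rw [hE k h2]; omega)
    (fun k h1 h2 h3 => by
      have := hwt k (by omega) h2
      rw [if_pos h3] at this; rw [hE k h2]; omega)
    (by
      simp only [E, show ¬ n + 1 ≤ n by omega, if_false]
      split_ifs <;> simp [hLq])
    (fun k h1 h2 h3 h4 => hDind _ h3 _ h4 (P.adj k h2))
    hfar
    (fun i j hi hij hj hw => by
      have hij2 := hfar i j hi hij hj hw
      obtain ⟨v, hvU, hvO, h1, h2⟩ := hw
      by_contra! h
      exact hcol ((hpk hvU hvO hij2 hj h1 h2).col_of_notMem C tf hT hI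
        (fun k _ _ => hne k (by omega) (by omega)) fun k h1 h2 => h k h1 h2))
    (fun i hi hi3 _ hd1 hd2 _ hw => by
      obtain ⟨v, hvU, hvO, h1, h2⟩ := hw
      exact hcol ((hpk hvU hvO (by omega) hi3 h1 h2).col_of_three C tf hT hI
        (fun k _ _ => hne k (by omega) (by omega)) hd1 hd2))
  refine hcol (P.remove_stretch C tf hmax hT hI hpq c (hs.trans hsa) hab hbn
    (fun k h1 h2 => by rw [← hE k (by omega)]; exact hcL k h1 h2) hcc
    (fun h => by rwa [← hE (b + 1) (by omega)])
    (fun h h' => ?_) ?_ fun v hv hvO k l h1 h2 h3 h4 h5 => hcW k l h1 h2 h3 ⟨v, hv, hvO, h4, h5⟩)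
  · subst h
    simpa [E, h'] using hcb
  · rcases hca with ⟨rfl, h⟩ | ⟨h1, h2⟩
    · exact hc0 _ h
    · rw [hE _ (by omega)] at h2
      exact Or.inl h2

/-- The main case: two adjacent precoloured vertices, one of which has a further boundary
neighbour. -/
lemma Core.col_edge [Finite V] (C : Core H Z U)
    (tf : ∀ a b c, H.Adj a b → H.Adj b c → H.Adj a c → False)
    (hDind : ∀ u ∈ D, ∀ v ∈ D, ¬ H.Adj u v)
    (hT : Tlt H D U.ncard) (hI : Inst H D Z U p q L) (hpq : H.Adj p q)
    (hex : ∀ v ∈ U, v ≠ p → v ≠ q → weight H D Z L v = 4) {α : ℕ} (hLp : L p = {α})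
    (hLq : (L q).card ≤ 1)
    (hz : z ∈ U) (hzO : z ∈ Nb H Z) (hpz : H.Adj p z) (hzq : z ≠ q) : Col H U L := by
  classical
  obtain ⟨n, y, P, hmax⟩ := exists_maximal_path hI.hp hI.pO hz hzO hpz hpq.ne hzq
  by_cases hzD : z ∈ D
  swap
  · refine P.col_from C tf hDind hmax hT hI hpq hex hLq le_rfl P.pos (by rwa [P.one]) α
      fun c hc => Or.inl ?_
    rw [P.zero, hLp]
    simpa using hc
  have hLz := weight_list_pos (hex z hz hpz.ne' hzq).ge
  obtain ⟨x, hx, hxα⟩ := exists_mem_notMem_of_card (s := L z) (t := {α}) (by simp; omega)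
  simp only [Finset.mem_singleton] at hxα
  by_cases hn : n = 1
  · subst hn
    refine P.remove_stretch C tf hmax hT hI hpq (a := 1) (b := 1) (fun _ => x) le_rfl le_rfl le_rfl
      (fun k h1 h2 => ?_) (fun k h1 h2 => by omega) (fun h => by omega) (fun _ h => ?_)
      (Or.inl ?_) fun v _ _ k l h1 h2 h3 => by omega
    · obtain rfl : k = 1 := by omega
      rwa [P.one]
    · rw [P.one] at h
      exact (tf p z q hpz h hpq).elim
    · simpa [P.zero, hLp] using hxα
  have hn2 : 2 ≤ n := by have := P.pos; omega
  have hy2 := P.adj 1 (by omega)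
  rw [P.one] at hy2
  set L' : V → Finset ℕ := Function.update L z {x, α} with hL'
  have hL'z : L' z = {x, α} := Function.update_self _ _ _
  have hL'n : ∀ v, v ≠ z → L' v = L v := fun v hv => Function.update_of_ne hv _ _
  have hL'p : L' p = {α} := by rw [hL'n p hpz.ne, hLp]
  have hL'q : L' q = L q := hL'n q hzq.symm
  have hex' : ∀ v ∈ U, v ≠ p → v ≠ q → weight H D Z L' v = 4 := by
    intro v hv hvp hvq
    by_cases hvz : v = z
    · subst hvz
      have h3 := hzO
      simp only [Nb, Set.mem_ofPred_eq] at h3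
      rw [weight, if_pos h3, if_pos hzD, hL'z, Finset.card_pair hxα]
    · rw [← hex v hv hvp hvq, weight, weight, hL'n v hvz]
  have hI' : Inst H D Z U p q L' := by
    refine ⟨hI.connZ, hI.disj, hI.hp, hI.hq, hI.pO, hI.qO, ?_, ?_, ?_,
      fun v hv hvp hvq => (hex' v hv hvp hvq).ge⟩
    · rw [hL'n p hpz.ne, hL'q]; exact hI.pq
    · rw [hL'p]; simp
    · rw [hL'q]; exact hI.qne
  obtain ⟨φ, h1, h2⟩ : Col H U L' := by
    refine P.col_from C tf hDind hmax hT hI' hpq hex' (by rwa [hL'q]) (s := 2) (by omega) hn2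
      (fun h => hDind z hzD _ h hy2) x fun c hc => ?_
    simp only [show 2 - 1 = 1 from rfl, P.one, hL'z, hL'p, Finset.mem_insert, Finset.mem_singleton,
      true_and, Finset.singleton_inj]
    by_cases h : c = α
    · exact Or.inr h.symm
    · exact Or.inl (by simp [hc, h])
  refine ⟨φ, fun v hv => ?_, h2⟩
  by_cases hvz : v = z
  · subst hvz
    have h3 := h1 v hv
    have h4 := h1 p hI.hp
    rw [hL'p, Finset.mem_singleton] at h4
    rw [hL'z, Finset.mem_insert, Finset.mem_singleton] at h3
    rcases h3 with h | h
    · rwa [h]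
    · exact absurd (h4.trans h.symm) (h2 p hI.hp v hv hpz)
  · rw [← hL'n v hvz]; exact h1 v hv

end PlanarChoice

namespace PlanarChoice

variable {V : Type} {H : SimpleGraph V} {D Z U S K : Set V} {p q z : V} {n : ℕ}
  {L : V → Finset ℕ}

lemma exists_closed_avoiding (hS : ¬ PreConn H S) (hpq : p = q ∨ H.Adj p q) :
    ∃ K ⊆ S, ClosedIn H S K ∧ K.Nonempty ∧ (S \ K).Nonempty ∧ p ∉ K ∧ q ∉ K := by
  have main : ∀ r : V, ∃ K ⊆ S, ClosedIn H S K ∧ K.Nonempty ∧ (S \ K).Nonempty ∧ r ∉ K := by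
    intro r
    unfold PreConn at hS
    push Not at hS
    obtain ⟨A, hA, hne, hcl, hAS⟩ := hS
    have hne' : (S \ A).Nonempty := by
      by_contra h
      rw [Set.not_nonempty_iff_eq_empty, Set.sdiff_eq_empty] at h
      exact hAS (hA.antisymm h)
    by_cases hr : r ∈ A
    · refine ⟨S \ A, Set.sdiff_subset, fun a ha b hb hab => ⟨hb, fun h => ?_⟩, hne', ?_,
        fun h => h.2 hr⟩
      · exact ha.2 (hcl b h a ha.1 hab.symm)
      · rwa [Set.sdiff_sdiff_cancel_left hA]
    · exact ⟨A, hA, hcl, hne, hne', hr⟩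
  by_cases hp : p ∈ S
  · obtain ⟨K, h1, h2, h3, h4, h5⟩ := main p
    refine ⟨K, h1, h2, h3, h4, h5, fun hq => ?_⟩
    rcases hpq with rfl | h
    · exact h5 hq
    · exact h5 (h2 q hq p hp h.symm)
  · obtain ⟨K, h1, h2, h3, h4, h5⟩ := main q
    exact ⟨K, h1, h2, h3, h4, fun h => hp (h1 h), h5⟩

lemma Inst.col_outside [Finite V] (hT : Tlt H D U.ncard) (hI : Inst H D Z U p q L) (hKU : K ⊆ U)
    (hK : K.Nonempty) (hp : p ∉ K) (hq : q ∉ K) : Col H (U \ K) L := by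
  refine hT Z _ p q L (Set.ncard_lt_ncard ⟨Set.sdiff_subset, fun h => ?_⟩)
    ⟨hI.connZ, hI.disj.mono_right Set.sdiff_subset, ⟨hI.hp, hp⟩, ⟨hI.hq, hq⟩, hI.pO, hI.qO, hI.pq,
      hI.pne, hI.qne, fun v hv => hI.big v hv.1⟩
  obtain ⟨k, hk⟩ := hK
  exact (h (hKU hk)).2 hk

lemma Inst.adj_or_eq (hI : Inst H D Z U p q L) : p = q ∨ H.Adj p q :=
  hI.pq.imp_right And.left

lemma Inst.col_of_not_preConn [Finite V] (hT : Tlt H D U.ncard) (hI : Inst H D Z U p q L)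
    (h : ¬ PreConn H U) : Col H U L := by
  obtain ⟨K, hKU, hcl, hne, hne', hp, hq⟩ := exists_closed_avoiding h hI.adj_or_eq
  obtain ⟨φ, h1, h2⟩ := hI.col_outside hT hKU hne hp hq
  obtain ⟨χ, h3, h4⟩ : Col H K L := by
    refine Inst0.col hT (Set.ncard_lt_ncard ⟨hKU, fun h => hp (h hI.hp)⟩)
      ⟨Or.inl hI.connZ, hI.disj.mono_right hKU, fun v hv => hI.big v (hKU hv) ?_ ?_⟩
    · rintro rfl; exact hp hv
    · rintro rfl; exact hq hv
  refine Col.glue (S := ∅) φ h1 h2 χ h3 (by simpa using h4) (by simp) fun u hu v hv huv => ?_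
  exact absurd (hcl u hu v hv.1 huv) hv.2

lemma Inst.col_of_cut [Finite V] (hT : Tlt H D U.ncard) (hI : Inst H D Z U p q L)
    (hU : PreConn H U) {c : V} (hc : c ∈ U) (h : ¬ PreConn H (U \ {c})) : Col H U L := by
  classical
  obtain ⟨K, hKS, hcl, hne, ⟨x, hx, hxK⟩, hp, hq⟩ := exists_closed_avoiding h hI.adj_or_eq
  have hKU : K ⊆ U := fun v hv => (hKS hv).1
  have hcK : c ∉ K := fun h => (hKS h).2 rfl
  obtain ⟨φ, h1, h2⟩ := hI.col_outside hT hKU hne hp hq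
  obtain ⟨Z', hZ', hZZ', hdis, hcO⟩ : ∃ Z', Conn H Z' ∧ Z ⊆ Z' ∧ Disjoint Z' (K ∪ {c}) ∧
      c ∈ Nb H Z' := by
    by_cases hcO : c ∈ Nb H Z
    · exact ⟨Z, hI.connZ, subset_rfl, hI.disj.mono_right
        (Set.union_subset hKU (Set.singleton_subset_iff.2 hc)), hcO⟩
    have hpc : p ∈ U \ {c} := ⟨hI.hp, fun h => hcO (h ▸ hI.pO)⟩
    have hsub := comp_subset (H := H) hpc
    have hAK : ∀ v ∈ comp H (U \ {c}) p, v ∉ K := by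
      intro v hv hvK
      have h3 := comp_subset_of_closed hcl hvK
      rw [comp_eq_of_mem hpc hv] at h3
      exact hp (h3 mem_comp_self)
    obtain ⟨a, ha, b, hb, hbA, hab⟩ := hU.touch (fun v hv => (hsub hv).1) ⟨p, mem_comp_self⟩ hc
      (fun h => (hsub h).2 rfl)
    have hbc : b = c := by
      by_contra h
      exact hbA (comp_closed a ha b ⟨hb, h⟩ hab)
    subst hbc
    obtain ⟨z, hz, hzp⟩ := hI.pO
    refine ⟨Z ∪ comp H (U \ {b}) p, hI.connZ.union (comp_conn hpc) ⟨z, hz, p, mem_comp_self, hzp⟩,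
      Set.subset_union_left, ?_, a, Or.inr ha, hab⟩
    rw [Set.disjoint_union_left]
    refine ⟨hI.disj.mono_right (Set.union_subset hKU (Set.singleton_subset_iff.2 hc)),
      Set.disjoint_left.2 ?_⟩
    rintro v hv (h | h)
    · exact hAK v hv h
    · exact (hsub hv).2 h
  obtain ⟨χ, h3, h4⟩ : Col H (K ∪ {c}) (Function.update L c {φ c}) := by
    refine hT Z' _ c c _ (Set.ncard_lt_ncard ⟨Set.union_subset hKU (Set.singleton_subset_iff.2 hc),
      fun h => (h hx.1).elim hxK hx.2⟩) ⟨hZ', hdis, Or.inr rfl, Or.inr rfl, hcO, hcO, Or.inl rfl,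
      by simp, by simp, fun v hv hvc _ => ?_⟩
    have hvK : v ∈ K := hv.resolve_right hvc
    refine weight_le_of _ (hI.big v (hKU hvK) ?_ ?_)
      (fun h => ⟨Nb_mono hZZ' h, by rw [Function.update_of_ne hvc]⟩)
      (fun _ => Or.inl (by rw [Function.update_of_ne hvc]))
    · rintro rfl; exact hp hvK
    · rintro rfl; exact hq hvK
  refine Col.glue (K := K) (S := {c}) φ h1 h2 χ (fun v hv => ?_) h4 ?_ fun u hu v hv huv => ?_
  · have := h3 v (Or.inl hv)
    rwa [Function.update_of_ne (by rintro rfl; exact hcK hv)] at this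
  · rintro v rfl
    simpa using h3 v (Or.inr rfl)
  · by_contra h
    exact hv.2 (hcl u hu v ⟨hv.1, h⟩ huv)

lemma Inst.col_of_separating_edge [Finite V] (hT : Tlt H D U.ncard) (hI : Inst H D Z U p q L)
    {u v : V} (hu : u ∈ U) (hv : v ∈ U) (huO : u ∈ Nb H Z) (hvO : v ∈ Nb H Z) (huv : H.Adj u v)
    (h : ¬ PreConn H (U \ {u, v})) : Col H U L := by
  classical
  obtain ⟨K, hKS, hcl, hne, ⟨x, hx, hxK⟩, hp, hq⟩ := exists_closed_avoiding h hI.adj_or_eq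
  have hKU : K ⊆ U := fun v hv => (hKS hv).1
  have huK : u ∉ K := fun h => (hKS h).2 (Or.inl rfl)
  have hvK : v ∉ K := fun h => (hKS h).2 (Or.inr rfl)
  obtain ⟨φ, h1, h2⟩ := hI.col_outside hT hKU hne hp hq
  have huvφ := h2 u ⟨hu, huK⟩ v ⟨hv, hvK⟩ huv
  set L' : V → Finset ℕ := fun a => if a = u ∨ a = v then {φ a} else L a with hL'
  have hL'u : L' u = {φ u} := by simp [hL']
  have hL'v : L' v = {φ v} := by simp [hL']
  have hL'n : ∀ a ∈ K, L' a = L a := by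
    intro a ha
    have h3 : ¬ (a = u ∨ a = v) := by
      rintro (rfl | rfl)
      exacts [huK ha, hvK ha]
    simp [hL', h3]
  have hUsub : K ∪ {u, v} ⊆ U :=
    Set.union_subset hKU (Set.insert_subset hu (Set.singleton_subset_iff.2 hv))
  obtain ⟨χ, h3, h4⟩ : Col H (K ∪ {u, v}) L' := by
    refine hT Z _ u v _ (Set.ncard_lt_ncard ⟨hUsub,
      fun h => (h hx.1).elim hxK hx.2⟩) ⟨hI.connZ, hI.disj.mono_right hUsub, Or.inr (Or.inl rfl),
      Or.inr (Or.inr rfl), huO, hvO, Or.inr ⟨huv, ?_⟩, ?_, ?_, fun a ha hau hav => ?_⟩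
    · rw [hL'u, hL'v]; simpa using huvφ
    · rw [hL'u]; simp
    · rw [hL'v]; simp
    have haK : a ∈ K := ha.resolve_right (by rintro (h | h) <;> contradiction)
    rw [weight, hL'n a haK]
    refine hI.big a (hKU haK) ?_ ?_
    · rintro rfl; exact hp haK
    · rintro rfl; exact hq haK
  refine Col.glue (K := K) (S := {u, v}) φ h1 h2 χ (fun a ha => ?_) h4 ?_
    fun a ha b hb hab => ?_
  · rw [← hL'n a ha]; exact h3 a (Or.inl ha)
  · rintro a (rfl | rfl)
    · have := h3 a (Or.inr (Or.inl rfl))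
      rwa [hL'u, Finset.mem_singleton] at this
    · have := h3 a (Or.inr (Or.inr rfl))
      rwa [hL'v, Finset.mem_singleton] at this
  · by_contra h
    exact hb.2 (hcl a ha b ⟨hb.1, h⟩ hab)

/-- The lists of an instance can be shrunk until all size bounds are attained. -/
lemma Inst.trim (hI : Inst H D Z U p q L) :
    ∃ L', Inst H D Z U p q L' ∧ (∀ v, L' v ⊆ L v) ∧ (L' p).card = 1 ∧ (L' q).card = 1 ∧
      ∀ v ∈ U, v ≠ p → v ≠ q → weight H D Z L' v = 4 := by
  classical
  have : ∀ v, ∃ T ⊆ L v, ((v = p ∨ v = q) → T.card = 1) ∧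
      (¬ (v = p ∨ v = q) → v ∈ U → weight H D Z (fun _ => T) v = 4) := by
    intro v
    by_cases h : v = p ∨ v = q
    · obtain ⟨x, hx⟩ : (L v).Nonempty := by
        rcases h with rfl | rfl
        exacts [hI.pne, hI.qne]
      exact ⟨{x}, by simpa, fun _ => by simp, fun h' => absurd h h'⟩
    · by_cases hv : v ∈ U
      · have hb := hI.big v hv (fun e => h (Or.inl e)) (fun e => h (Or.inr e))
        obtain ⟨T, hT, hTc⟩ := Finset.exists_subset_card_eq (s := L v)
          (n := (L v).card - (weight H D Z L v - 4)) (by omega)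
        refine ⟨T, hT, fun h' => absurd h' h, fun _ _ => ?_⟩
        unfold weight at *
        rw [hTc]
        split_ifs at * <;> omega
      · exact ⟨L v, subset_rfl, fun h' => absurd h' h, fun _ h' => absurd h' hv⟩
  choose T hTs h1 h2 using this
  have hp := h1 p (Or.inl rfl)
  have hq := h1 q (Or.inr rfl)
  have hw : ∀ v ∈ U, v ≠ p → v ≠ q → weight H D Z T v = 4 := fun v hv hvp hvq =>
    h2 v (by rintro (h | h) <;> contradiction) hv
  refine ⟨T, ⟨hI.connZ, hI.disj, hI.hp, hI.hq, hI.pO, hI.qO, ?_, ?_, ?_,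
    fun v hv hvp hvq => (hw v hv hvp hvq).ge⟩, hTs, hp, hq, hw⟩
  · exact hI.pq.imp_right fun h => ⟨h.1, h.2.mono (hTs p) (hTs q)⟩
  · exact Finset.card_pos.1 (by omega)
  · exact Finset.card_pos.1 (by omega)

lemma Core.col_pair [Finite V] (C : Core H Z U)
    (tf : ∀ a b c, H.Adj a b → H.Adj b c → H.Adj a c → False)
    (hDind : ∀ u ∈ D, ∀ v ∈ D, ¬ H.Adj u v)
    (hT : Tlt H D U.ncard) (hI : Inst H D Z U p q L) (hpq : H.Adj p q)
    (hex : ∀ v ∈ U, v ≠ p → v ≠ q → weight H D Z L v = 4) (hLp : (L p).card = 1)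
    (hLq : (L q).card = 1) : Col H U L := by
  obtain ⟨α, hα⟩ := Finset.card_eq_one.1 hLp
  by_cases hz : ∃ z ∈ U, z ∈ Nb H Z ∧ H.Adj p z ∧ z ≠ q
  · obtain ⟨z, h1, h2, h3, h4⟩ := hz
    exact C.col_edge tf hDind hT hI hpq hex hα hLq.le h1 h2 h3 h4
  push Not at hz
  have hqp : q ∉ ({p} : Set V) := fun h => hpq.ne' h
  have hqO' := Nb_mono (H := H) (Z := Z) (Z' := Z ∪ {p}) Set.subset_union_left hI.qO
  have hdis : Disjoint (L p) (L q) := hI.pq.elim (fun h => absurd h hpq.ne) And.right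
  obtain ⟨φ, h1, h2, h3⟩ := removal (Q := {p}) (p := q) (q := q) (ψ := fun _ => α) (L := L) hT
    (Set.ncard_lt_ncard ⟨Set.sdiff_subset, fun h => (h hI.hp).2 rfl⟩) hI.connZ hI.disj
    (by rintro v rfl; exact hI.pO) ⟨hI.hq, hqp⟩ ⟨hI.hq, hqp⟩ hqO' hqO' (Or.inl rfl) hI.qne hI.qne
    (fun v hv hvq _ => hI.big v hv.1 hv.2 hvq) (by rintro u rfl v rfl h; exact (H.irrefl h).elim)
    (by
      rintro v hv hvO u rfl hvu hmem
      have hvO' : v ∈ Nb H Z := by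
        rcases hvO with h | rfl | rfl
        exacts [h, hI.qO, hI.qO]
      have := hz v hv.1 hvO' hvu.symm
      subst this
      rw [hα, Finset.disjoint_singleton_left] at hdis
      exact absurd hmem hdis)
    (fun _ _ _ _ _ _ _ _ _ _ _ => rfl)
  refine ⟨φ, fun v hv => ?_, h3⟩
  by_cases hvp : v = p
  · rw [hvp, h2 p rfl, hα]; simp
  · exact h1 v ⟨hv, hvp⟩

lemma Core.col_single [Finite V] (C : Core H Z U)
    (tf : ∀ a b c, H.Adj a b → H.Adj b c → H.Adj a c → False)
    (hDind : ∀ u ∈ D, ∀ v ∈ D, ¬ H.Adj u v)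
    (hT : Tlt H D U.ncard) (hI : Inst H D Z U p p L)
    (hex : ∀ v ∈ U, v ≠ p → weight H D Z L v = 4) (hLp : (L p).card = 1) : Col H U L := by
  classical
  obtain ⟨α, hα⟩ := Finset.card_eq_one.1 hLp
  by_cases hz : ∃ z ∈ U, z ∈ Nb H Z ∧ H.Adj p z
  · obtain ⟨z, hzU, hzO, hpz⟩ := hz
    have hLz := weight_list_pos (hI.big z hzU hpz.ne' hpz.ne')
    obtain ⟨x, hx, hxα⟩ := exists_mem_notMem_of_card (s := L z) (t := {α}) (by simp; omega)
    simp only [Finset.mem_singleton] at hxα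
    set L' : V → Finset ℕ := Function.update L z {x} with hL'
    have hL'z : L' z = {x} := Function.update_self _ _ _
    have hL'n : ∀ v, v ≠ z → L' v = L v := fun v hv => Function.update_of_ne hv _ _
    have hL'p : L' p = {α} := by rw [hL'n p hpz.ne, hα]
    have hex' : ∀ v ∈ U, v ≠ p → v ≠ z → weight H D Z L' v = 4 := fun v hv hvp hvz => by
      rw [weight, hL'n v hvz]; exact hex v hv hvp
    obtain ⟨φ, h1, h2⟩ := C.col_pair (p := p) (q := z) (L := L') tf hDind hT
      ⟨hI.connZ, hI.disj, hI.hp, hzU, hI.pO, hzO,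
        Or.inr ⟨hpz, by rw [hL'z, hL'p]; simpa using Ne.symm hxα⟩,
        by rw [hL'p]; simp, by rw [hL'z]; simp, fun v hv h h' => (hex' v hv h h').ge⟩ hpz hex'
      (by rw [hL'p]; simp) (by rw [hL'z]; simp)
    refine ⟨φ, fun v hv => ?_, h2⟩
    have := h1 v hv
    by_cases hvz : v = z
    · subst hvz
      rw [hL'z, Finset.mem_singleton] at this
      rwa [this]
    · rwa [hL'n v hvz] at this
  · push Not at hz
    obtain ⟨φ, h1, h2⟩ : Col H (U \ {p}) (fun v => if H.Adj p v then (L v).erase α else L v) := by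
      refine Inst0.col (Z := Z ∪ {p}) hT
        (Set.ncard_lt_ncard ⟨Set.sdiff_subset, fun h => (h hI.hp).2 rfl⟩) ⟨Or.inl ?_, ?_, ?_⟩
      · exact hI.connZ.union_of_forall (by rintro v rfl; exact hI.pO)
      · rw [Set.disjoint_union_left]
        exact ⟨hI.disj.mono_right Set.sdiff_subset, Set.disjoint_sdiff_right⟩
      · intro v hv
        refine weight_le_of _ (hI.big v hv.1 hv.2 hv.2) (fun h => ?_) (fun h => ?_)
        · exact ⟨Nb_mono Set.subset_union_left h, by rw [if_neg (hz v hv.1 h)]⟩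
        · by_cases hpv : H.Adj p v
          · refine Or.inr ⟨⟨p, Or.inr rfl, hpv⟩, ?_⟩
            rw [if_pos hpv]
            have := Finset.pred_card_le_card_erase (s := L v) (a := α)
            omega
          · exact Or.inl (by rw [if_neg hpv])
    have hmem : ∀ v ∈ U \ {p}, φ v ∈ L v ∧ (H.Adj p v → φ v ≠ α) := by
      intro v hv
      have := h1 v hv
      dsimp only at this
      split_ifs at this with h
      · exact ⟨Finset.mem_of_mem_erase this, fun _ => Finset.ne_of_mem_erase this⟩
      · exact ⟨this, fun h' => absurd h' h⟩
    refine ⟨Function.update φ p α, fun v hv => ?_, fun u hu v hv huv => ?_⟩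
    · by_cases hvp : v = p
      · subst hvp; rw [Function.update_self, hα]; simp
      · rw [Function.update_of_ne hvp]; exact (hmem v ⟨hv, hvp⟩).1
    · by_cases hup : u = p
      · subst hup
        rw [Function.update_self, Function.update_of_ne huv.ne']
        exact ((hmem v ⟨hv, huv.ne'⟩).2 huv).symm
      · rw [Function.update_of_ne hup]
        by_cases hvp : v = p
        · subst hvp
          rw [Function.update_self]
          exact (hmem u ⟨hu, hup⟩).2 huv.symm
        · rw [Function.update_of_ne hvp]
          exact h2 u ⟨hu, hup⟩ v ⟨hv, hvp⟩ huv

lemma Inst.col_of_lt [Finite V] (k5 : NoK5 H) (k33 : NoK33 H)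
    (tf : ∀ a b c, H.Adj a b → H.Adj b c → H.Adj a c → False)
    (hDind : ∀ u ∈ D, ∀ v ∈ D, ¬ H.Adj u v)
    (hT : Tlt H D U.ncard) (hI : Inst H D Z U p q L) : Col H U L := by
  obtain ⟨L', hI', hsub, hp, hq, hex⟩ := hI.trim
  suffices h : Col H U L' by
    obtain ⟨φ, h1, h2⟩ := h
    exact ⟨φ, fun v hv => hsub v (h1 v hv), h2⟩
  by_cases hU : PreConn H U
  swap
  · exact hI'.col_of_not_preConn hT hU
  by_cases hcut : ∀ c ∈ U, PreConn H (U \ {c})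
  swap
  · push Not at hcut
    obtain ⟨c, hc, h⟩ := hcut
    exact hI'.col_of_cut hT hU hc h
  by_cases hsep : ∀ u ∈ U, ∀ v ∈ U, u ∈ Nb H Z → v ∈ Nb H Z → H.Adj u v → PreConn H (U \ {u, v})
  swap
  · push Not at hsep
    obtain ⟨u, hu, v, hv, huO, hvO, huv, h⟩ := hsep
    exact hI'.col_of_separating_edge hT hu hv huO hvO huv h
  have C : Core H Z U := ⟨k5, k33, hI.connZ, hI.disj, hU, hcut, hsep⟩
  by_cases hpq : p = q
  · subst hpq
    exact C.col_single tf hDind hT hI' (fun v hv h => hex v hv h h) hp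
  · exact C.col_pair tf hDind hT hI' (hI.adj_or_eq.resolve_left hpq) hex hp hq

lemma tlt_all [Finite V] (k5 : NoK5 H) (k33 : NoK33 H)
    (tf : ∀ a b c, H.Adj a b → H.Adj b c → H.Adj a c → False)
    (hDind : ∀ u ∈ D, ∀ v ∈ D, ¬ H.Adj u v) (n : ℕ) : Tlt H D n := by
  induction n with
  | zero => intro Z U p q L h; omega
  | succ n ih =>
    intro Z U p q L h hI
    exact hI.col_of_lt k5 k33 tf hDind
      fun Z' U' p' q' L' h' => ih Z' U' p' q' L' (by omega)

theorem exists_colouring [Finite V] (k5 : NoK5 H) (k33 : NoK33 H)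
    (tf : ∀ a b c, H.Adj a b → H.Adj b c → H.Adj a c → False)
    (hDind : ∀ u ∈ D, ∀ v ∈ D, ¬ H.Adj u v) (hL : ∀ v, v ∉ D → 4 ≤ (L v).card)
    (hL' : ∀ v ∈ D, 3 ≤ (L v).card) :
    ∃ φ : V → ℕ, (∀ v, φ v ∈ L v) ∧ ∀ u v, H.Adj u v → φ u ≠ φ v := by
  obtain ⟨φ, h1, h2⟩ := Inst0.col (U := Set.univ) (Z := ∅) (L := L)
    (tlt_all k5 k33 tf hDind ((Set.univ : Set V).ncard + 1)) (Nat.lt_succ_self _)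
    ⟨Or.inr rfl, by simp, fun v _ => by
      unfold weight
      by_cases h : v ∈ D
      · have := hL' v h
        simp [h]; omega
      · have := hL v h
        simp [h]; omega⟩
  exact ⟨φ, fun v => h1 v trivial, fun u v => h2 u trivial v trivial⟩

end PlanarChoice

namespace PlanarChoice

open Complex in
lemma exists_continuous_log {A : Type*} [TopologicalSpace A] [SimplyConnectedSpace A]
    [LocallyPathConnectedSpace A] {F : A → ℂ} (hF : Continuous F) (h0 : ∀ a, F a ≠ 0) :
    ∃ θ : A → ℂ, Continuous θ ∧ ∀ a, exp (θ a) = F a := by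
  obtain ⟨a₀⟩ : Nonempty A := inferInstance
  obtain ⟨f, ⟨-, hf⟩, -⟩ := isCoveringMapOn_exp.existsUnique_continuousMap_lifts
    ⟨F, hF⟩ (exp_log (h0 a₀)) h0
  exact ⟨f, f.continuous, congrFun hf⟩

open Complex in
lemma continuous_log_unique {g g' : ℝ → ℂ} (hg : Continuous g) (hg' : Continuous g')
    (h : ∀ t, exp (g t) = exp (g' t)) : g 1 - g 0 = g' 1 - g' 0 := by
  have := (isCoveringMapOn_exp.existsUnique_continuousMap_lifts (a₀ := (0 : ℝ)) (e₀ := g 0)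
    ⟨fun t => exp (g t), by fun_prop⟩ rfl fun t => exp_ne_zero _).unique
    (y₁ := ⟨g, hg⟩) (y₂ := ⟨fun t => g' t + (g 0 - g' 0), by fun_prop⟩) ⟨rfl, rfl⟩
    ⟨by simp, by
      ext t
      simp [exp_add, exp_sub, h]⟩
  have := congrArg (fun f : C(ℝ, ℂ) => f 1) this
  simp only [ContinuousMap.coe_mk] at this
  rw [this]; ring

open Complex in
/-- The change of a continuous logarithm of `γ - z` between `0` and `1` is determined, up to an
integer depending only on `γ` and `z`, by the end points. -/
lemma exists_winding (γ : ℝ → ℂ) (z : ℂ) : ∃ n : ℤ, ∀ g : ℝ → ℂ, Continuous g →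
    (∀ t, exp (g t) = γ t - z) →
    g 1 - g 0 = log (γ 1 - z) - log (γ 0 - z) + n * (2 * Real.pi * I) := by
  by_cases hex : ∃ g : ℝ → ℂ, Continuous g ∧ ∀ t, exp (g t) = γ t - z
  · obtain ⟨g, hg, hgz⟩ := hex
    have h0 : γ 0 - z ≠ 0 := hgz 0 ▸ exp_ne_zero _
    have h1 : γ 1 - z ≠ 0 := hgz 1 ▸ exp_ne_zero _
    obtain ⟨a, ha⟩ := exp_eq_exp_iff_exists_int.1 ((hgz 0).trans (exp_log h0).symm)
    obtain ⟨b, hb⟩ := exp_eq_exp_iff_exists_int.1 ((hgz 1).trans (exp_log h1).symm)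
    refine ⟨b - a, fun g' hg' hgz' => ?_⟩
    rw [continuous_log_unique hg' hg fun t => (hgz' t).trans (hgz t).symm, ha, hb]
    push_cast
    ring
  · exact ⟨0, fun g hg hgz => (hex ⟨g, hg, hgz⟩).elim⟩

open Complex in
lemma exists_log_sub_log_neg (z : ℂ) (hz : z ≠ 0) :
    ∃ n : ℤ, log z - log (-z) = Real.pi * I * (1 - 2 * n) := by
  have : exp (log z) = exp (log (-z) + Real.pi * I) := by
    rw [exp_add, exp_log hz, exp_log (neg_ne_zero.2 hz), exp_pi_mul_I]; ring
  obtain ⟨n, hn⟩ := exp_eq_exp_iff_exists_int.1 this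
  refine ⟨-n, ?_⟩
  rw [hn]; push_cast; ring

/-- An integer `N γ z` counts how `γ` winds around `z`, and `b` records the half plane of a
difference; for disjoint curves these satisfy the relation obtained by going round a square. -/
lemma exists_crossing_relation : ∃ (N : (ℝ → ℂ) → ℂ → ℤ) (b : ℂ → ℤ),
    (∀ z, z ≠ 0 → b z + b (-z) = 1) ∧ ∀ P Q : ℝ → ℂ, Continuous P → Continuous Q →
    (∀ s t, P s ≠ Q t) →
    N P (Q 0) + N Q (P 1) - N P (Q 1) - N Q (P 0)
      = b (P 1 - Q 0) - b (P 0 - Q 0) - b (P 1 - Q 1) + b (P 0 - Q 1) := by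
  choose N hN using exists_winding
  choose! b hb using exists_log_sub_log_neg
  have hpi : (Real.pi : ℂ) * Complex.I ≠ 0 := by simp [Real.pi_ne_zero]
  refine ⟨N, b, fun z hz => ?_, fun P Q hP hQ hPQ => ?_⟩
  · have h1 := hb z hz
    have h2 := hb (-z) (neg_ne_zero.2 hz)
    rw [neg_neg] at h2
    have h3 : (Real.pi : ℂ) * Complex.I * (b z + b (-z)) = Real.pi * Complex.I * 1 := by
      linear_combination (1 / 2 : ℂ) * (h1 + h2)
    exact_mod_cast mul_left_cancel₀ hpi h3
  · obtain ⟨θ, hθ, hexp⟩ := exists_continuous_log (A := ℝ × ℝ) (F := fun x => P x.1 - Q x.2)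
      (by fun_prop) fun x => sub_ne_zero.2 (hPQ _ _)
    have hexp' : ∀ s t, Complex.exp (θ (s, t) + Real.pi * Complex.I) = Q t - P s := fun s t => by
      rw [Complex.exp_add, hexp, Complex.exp_pi_mul_I]; ring
    have e1 := hN P (Q 0) (fun s => θ (s, 0)) (by fun_prop) fun s => hexp _
    have e2 := hN P (Q 1) (fun s => θ (s, 1)) (by fun_prop) fun s => hexp _
    have e3 := hN Q (P 0) (fun t => θ (0, t) + Real.pi * Complex.I) (by fun_prop) (hexp' 0)
    have e4 := hN Q (P 1) (fun t => θ (1, t) + Real.pi * Complex.I) (by fun_prop) (hexp' 1)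
    have b1 := hb _ (sub_ne_zero.2 (hPQ 1 0))
    have b2 := hb _ (sub_ne_zero.2 (hPQ 0 0))
    have b3 := hb _ (sub_ne_zero.2 (hPQ 1 1))
    have b4 := hb _ (sub_ne_zero.2 (hPQ 0 1))
    simp only [neg_sub] at b1 b2 b3 b4
    have h3 : (Real.pi : ℂ) * Complex.I *
        (N P (Q 0) + N Q (P 1) - N P (Q 1) - N Q (P 0)) = Real.pi * Complex.I *
        (b (P 1 - Q 0) - b (P 0 - Q 0) - b (P 1 - Q 1) + b (P 0 - Q 1)) := by
      linear_combination (1 / 2 : ℂ) * (e2 + e3 - e1 - e4 - b1 + b2 + b3 - b4)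
    exact_mod_cast mul_left_cancel₀ hpi h3

variable {V : Type} {G : SimpleGraph V}

/-- The part of the drawing that belongs to the vertices and edges inside `S`. -/
def drawing (e : PlaneEmbedding G) (S : Set V) : Set (ℝ × ℝ) :=
  {p | (∃ v ∈ S, p = e.pos v) ∨ ∃ u ∈ S, ∃ v ∈ S, G.Adj u v ∧ p ∈ Set.range (e.arc u v)}

lemma disjoint_drawing (e : PlaneEmbedding G) {S T : Set V} (h : Disjoint S T) :
    Disjoint (drawing e S) (drawing e T) := by
  have hne : ∀ {u v}, u ∈ S → v ∈ T → u ≠ v := fun hu hv huv =>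
    Set.disjoint_left.1 h hu (huv ▸ hv)
  rw [Set.disjoint_left]
  rintro p (⟨v, hv, rfl⟩ | ⟨u, hu, v, hv, huv, hp⟩) (⟨w, hw, hpw⟩ | ⟨x, hx, y, hy, hxy, hpw⟩)
  · exact hne hv hw (e.pos_inj hpw)
  · exact e.arc_avoid x y v hxy (hne hv hx) (hne hv hy) hpw
  · exact e.arc_avoid u v w huv (hne hu hw).symm (hne hv hw).symm (hpw ▸ hp)
  · have hpair : ({u, v} : Set V) ∩ {x, y} = ∅ := by
      ext a
      simp only [Set.mem_inter_iff, Set.mem_insert_iff, Set.mem_singleton_iff,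
        Set.mem_empty_iff_false, iff_false]
      rintro ⟨rfl | rfl, rfl | rfl⟩
      exacts [hne hu hx rfl, hne hu hy rfl, hne hv hx rfl, hne hv hy rfl]
    have hne' : ({u, v} : Set V) ≠ {x, y} := fun he => by
      have hu' : u ∈ ({u, v} : Set V) ∩ {x, y} := ⟨by simp, he ▸ by simp⟩
      simp [hpair] at hu'
    have := e.arcs_meet_only_at_endpoints u v x y huv hxy hne' ⟨hp, hpw⟩
    simp [hpair] at this

lemma joinedIn_drawing (e : PlaneEmbedding G) {S : Set V} (hS : PreConn G S) {x y : V}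
    (hx : x ∈ S) (hy : y ∈ S) :
    JoinedIn (drawing e S) (e.pos x) (e.pos y) := by
  have := hS {w | w ∈ S ∧ JoinedIn (drawing e S) (e.pos x) (e.pos w)} (fun w hw => hw.1)
    ⟨x, hx, JoinedIn.refl (Or.inl ⟨x, hx, rfl⟩)⟩ (fun a ha b hb hab => ⟨hb, ha.2.trans
      ⟨⟨⟨e.arc a b, e.arc_cont a b hab⟩, e.arc_start a b hab, e.arc_end a b hab⟩,
        fun t => Or.inr ⟨a, ha.1, b, hb, hab, t, rfl⟩⟩⟩)
  exact (this.ge hy).2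

lemma exists_curve (e : PlaneEmbedding G) {S : Set V} (hS : PreConn G S) {x y : V}
    (hx : x ∈ S) (hy : y ∈ S) :
    ∃ γ : ℝ → ℂ, Continuous γ ∧ γ 0 = Complex.equivRealProdCLM.symm (e.pos x) ∧
      γ 1 = Complex.equivRealProdCLM.symm (e.pos y) ∧
      ∀ t, ∃ p ∈ drawing e S, γ t = Complex.equivRealProdCLM.symm p := by
  obtain ⟨γ, hγ⟩ := joinedIn_drawing e hS hx hy
  refine ⟨fun t => Complex.equivRealProdCLM.symm (γ.extend t), by fun_prop, by simp, by simp,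
    fun t => ⟨_, ?_, rfl⟩⟩
  exact hγ _

/-- In a drawing of a graph with connected branch sets `A`, joined as prescribed by `E`, the
crossing relations hold for all pairs of edges of `E` without common end vertex. -/
lemma exists_relations (e : PlaneEmbedding G) {n : ℕ} {E : Fin n → Fin n → Prop} {A : Fin n → Set V}
    (hA : ∀ i, Conn G (A i)) (hd : ∀ i j, i < j → Disjoint (A i) (A j))
    (ht : ∀ i j, E i j → Touch G (A i) (A j)) :
    ∃ (M : Fin n → Fin n → Fin n → ℤ) (B : Fin n → Fin n → ℤ),
      (∀ i j, i < j → B i j + B j i = 1) ∧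
      ∀ i j k l, E i j → E k l → i ≠ k → i ≠ l → j ≠ k → j ≠ l →
        M i j k + M k l j - M i j l - M k l i = B j k - B i k - B j l + B i l := by
  have hd' : ∀ i j, i ≠ j → Disjoint (A i) (A j) := fun i j hij =>
    hij.lt_or_gt.elim (hd i j) fun h => (hd j i h).symm
  choose x hx using fun i => (hA i).nonempty
  have hcurve : ∀ i j, E i j → _ := fun i j hij =>
    exists_curve e ((hA i).union (hA j) (ht i j hij)).2 (Or.inl (hx i)) (Or.inr (hx j))
  choose! P hP h0 h1 hmem using hcurve
  obtain ⟨N, b, hb, hN⟩ := exists_crossing_relation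
  set r : Fin n → ℂ := fun i => Complex.equivRealProdCLM.symm (e.pos (x i)) with hr
  refine ⟨fun i j k => N (P i j) (r k), fun i j => b (r i - r j), fun i j hij => ?_,
    fun i j k l hij hkl hik hil hjk hjl => ?_⟩
  · have hne : r i ≠ r j := fun h => Set.disjoint_left.1 (hd i j hij) (hx i)
      (e.pos_inj (Complex.equivRealProdCLM.symm.injective h) ▸ hx j)
    simpa using hb _ (sub_ne_zero.2 hne)
  · have := hN _ _ (hP i j hij) (hP k l hkl) fun s t hst => by
      obtain ⟨p, hp, hp'⟩ := hmem i j hij s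
      obtain ⟨q, hq, hq'⟩ := hmem k l hkl t
      have hpq : p = q := Complex.equivRealProdCLM.symm.injective (hp' ▸ hq' ▸ hst)
      refine Set.disjoint_left.1 (disjoint_drawing e ?_) hp (hpq ▸ hq)
      rw [Set.disjoint_union_left, Set.disjoint_union_right, Set.disjoint_union_right]
      exact ⟨⟨hd' _ _ hik, hd' _ _ hil⟩, hd' _ _ hjk, hd' _ _ hjl⟩
    rwa [h0 i j hij, h0 k l hkl, h1 i j hij, h1 k l hkl] at this

/-- Going round the squares of all pairs of disjoint edges gives an odd integer that vanishes. -/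
lemma noK5_of_isPlanar (h : G.IsPlanar) : NoK5 G := by
  obtain ⟨e⟩ := h
  intro A hA hd ht
  obtain ⟨M, B, flip, key⟩ := exists_relations e (E := fun i j => i < j)
    hA hd (fun i j hij => ht i j hij)
  replace key := fun i j k l (hd : decide (i < j ∧ k < l ∧ i ≠ k ∧ i ≠ l ∧ j ≠ k ∧ j ≠ l) = true) =>
    have h := of_decide_eq_true hd
    key i j k l h.1 h.2.1 h.2.2.1 h.2.2.2.1 h.2.2.2.2.1 h.2.2.2.2.2
  have := key 0 1 2 3 rfl
  have := key 0 1 2 4 rfl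
  have := key 0 1 3 4 rfl
  have := key 0 2 1 3 rfl
  have := key 0 2 1 4 rfl
  have := key 0 2 3 4 rfl
  have := key 0 3 1 2 rfl
  have := key 0 3 1 4 rfl
  have := key 0 3 2 4 rfl
  have := key 0 4 1 2 rfl
  have := key 0 4 1 3 rfl
  have := key 0 4 2 3 rfl
  have := key 1 2 3 4 rfl
  have := key 1 3 2 4 rfl
  have := key 1 4 2 3 rfl
  have := flip 0 1 (by decide)
  have := flip 0 2 (by decide)
  have := flip 0 3 (by decide)
  have := flip 0 4 (by decide)
  have := flip 1 2 (by decide)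
  have := flip 1 3 (by decide)
  have := flip 1 4 (by decide)
  have := flip 2 3 (by decide)
  have := flip 2 4 (by decide)
  have := flip 3 4 (by decide)
  clear key flip
  omega

lemma noK33_of_isPlanar (h : G.IsPlanar) : NoK33 G := by
  obtain ⟨e⟩ := h
  intro A hA hd ht
  obtain ⟨M, B, flip, key⟩ := exists_relations e (E := fun i j => i < 3 ∧ 3 ≤ j)
    hA hd (fun i j hij => ht i j hij.1 hij.2)
  replace key := fun i j k l
      (hd : decide ((i < 3 ∧ 3 ≤ j) ∧ (k < 3 ∧ 3 ≤ l) ∧ i ≠ k ∧ i ≠ l ∧ j ≠ k ∧ j ≠ l) = true) =>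
    have h := of_decide_eq_true hd
    key i j k l h.1 h.2.1 h.2.2.1 h.2.2.2.1 h.2.2.2.2.1 h.2.2.2.2.2
  have := key 0 3 1 4 rfl
  have := key 0 3 1 5 rfl
  have := key 0 3 2 4 rfl
  have := key 0 3 2 5 rfl
  have := key 0 4 1 3 rfl
  have := key 0 4 1 5 rfl
  have := key 0 4 2 3 rfl
  have := key 0 4 2 5 rfl
  have := key 0 5 1 3 rfl
  have := key 0 5 1 4 rfl
  have := key 0 5 2 3 rfl
  have := key 0 5 2 4 rfl
  have := key 1 3 2 4 rfl
  have := key 1 3 2 5 rfl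
  have := key 1 4 2 3 rfl
  have := key 1 4 2 5 rfl
  have := key 1 5 2 3 rfl
  have := key 1 5 2 4 rfl
  have := flip 0 1 (by decide)
  have := flip 0 2 (by decide)
  have := flip 0 3 (by decide)
  have := flip 0 4 (by decide)
  have := flip 0 5 (by decide)
  have := flip 1 2 (by decide)
  have := flip 1 3 (by decide)
  have := flip 1 4 (by decide)
  have := flip 1 5 (by decide)
  have := flip 2 3 (by decide)
  have := flip 2 4 (by decide)
  have := flip 2 5 (by decide)
  have := flip 3 4 (by decide)
  have := flip 3 5 (by decide)
  have := flip 4 5 (by decide)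
  clear key flip
  omega

end PlanarChoice
theorem trianglefree_planar_indep_3_4_choosable {V : Type} [Fintype V]
    (G : SimpleGraph V) (hplanar : G.IsPlanar) (htf : G.CliqueFree 3)
    (X : Set V) (hX : ∀ u ∈ X, ∀ v ∈ X, ¬ G.Adj u v)
    (L : V → Finset ℕ)
    (hL4 : ∀ v, v ∉ X → (L v).card = 4)
    (hL3 : ∀ v, v ∈ X → (L v).card = 3) :
    ∃ φ : V → ℕ, ProperListColoring G L φ := by
  classical
  exact PlanarChoice.exists_colouring (PlanarChoice.noK5_of_isPlanar hplanar)
    (PlanarChoice.noK33_of_isPlanar hplanar)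
    (fun a b c hab hbc hac =>
      htf {a, b, c} (SimpleGraph.is3Clique_triple_iff.2 ⟨hab, hac, hbc⟩))
    hX (fun v hv => (hL4 v hv).ge) fun v hv => (hL3 v hv).ge
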